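/- arXiv:0904.2443 — 2 statements merged into one kernel-verified Lean document; each statement's English description precedes it below -/
import Mathlib

section
/- Let f, g ∈ L¹ ∩ L∞(ℝ⁶) be nonnegative and spherically symmetric. Then g ∈ Eq(f) if and only if for every C¹ function G : [0,∞)×[0,∞) → [0,∞) with G(0,ℓ) = 0 for all ℓ ≥ 0 one has ∫_{ℝ⁶} G(f(x,v), |x×v|²) dx dv = ∫_{ℝ⁶} G(g(x,v), |x×v|²) dx dv. -/
noncomputable section

open MeasureTheory Real Filter Set Topology
open scoped ENNReal NNReal

abbrev E3 : Type := EuclideanSpace ℝ (Fin 3)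
abbrev Phase : Type := E3 × E3

/-- Spherical symmetry: invariance under all rotations of `ℝ³` acting jointly on `x` and `v`. -/
def SphSym (f : Phase → ℝ) : Prop :=
  ∀ R : E3 ≃ₗᵢ[ℝ] E3, LinearMap.det (R.toLinearEquiv : E3 →ₗ[ℝ] E3) = 1 →
    ∀ z : Phase, f (R z.1, R z.2) = f z

/-- `|x × v|²`, via the Lagrange identity. -/
def ellOf (z : Phase) : ℝ := ‖z.1‖ ^ 2 * ‖z.2‖ ^ 2 - (inner ℝ z.1 z.2 : ℝ) ^ 2

/-- Spatial density. -/
def rhoF (f : Phase → ℝ) (x : E3) : ℝ := ∫ v : E3, f (x, v)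

/-- Poisson field. -/
def phiF (f : Phase → ℝ) (x : E3) : ℝ := - ∫ y : E3, rhoF f y / (4 * π * ‖x - y‖)

/-- Radial representation of the Poisson field. -/
def phiRad (f : Phase → ℝ) (r : ℝ) : ℝ :=
  phiF f (r • (EuclideanSpace.single (0 : Fin 3) (1:ℝ)))

def mass (f : Phase → ℝ) : ℝ := ∫ z : Phase, f z

def kineticE (f : Phase → ℝ) : ℝ := ∫ z : Phase, ‖z.2‖ ^ 2 * f z

def gradPhi (f : Phase → ℝ) (x : E3) : E3 := gradient (phiF f) x

def fieldSq (f : Phase → ℝ) : ℝ := ∫ x : E3, ‖gradPhi f x‖ ^ 2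

/-- `L²` distance between the force fields of `f` and `g`. -/
def fieldDist (f g : Phase → ℝ) : ℝ :=
  Real.sqrt (∫ x : E3, ‖gradPhi f x - gradPhi g x‖ ^ 2)

/-- The Hamiltonian. -/
def Ham (f : Phase → ℝ) : ℝ := kineticE f / 2 - fieldSq f / 2

/-- The norm of the energy space. -/
def eNormE (f : Phase → ℝ) : ℝ≥0∞ :=
  eLpNorm f 1 volume + eLpNorm f ⊤ volume +
    ∫⁻ z : Phase, (‖z.2‖₊ : ℝ≥0∞) ^ 2 * (‖f z‖₊ : ℝ≥0∞)

def memE (f : Phase → ℝ) : Prop := Measurable f ∧ (∀ z, 0 ≤ f z) ∧ eNormE f < ⊤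

def memErad (f : Phase → ℝ) : Prop := memE f ∧ SphSym f

/-- Density of the measure `ν_ℓ`. -/
def nuDens (ℓ : ℝ) (p : ℝ × ℝ) : ℝ≥0∞ :=
  if 0 < p.1 ∧ ℓ < p.1 ^ 2 * p.2 ^ 2 then
    ENNReal.ofReal (4 * π ^ 2 * p.1 * |p.2| / Real.sqrt (p.1 ^ 2 * p.2 ^ 2 - ℓ))
  else 0

def nuMeas (ℓ : ℝ) : Measure (ℝ × ℝ) := volume.withDensity (nuDens ℓ)

/-- Representative phase point with `|x| = r`, `|v| = |u|`, `|x×v|² = ℓ` and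
`x·v = sign u · √(r²u²-ℓ)`. -/
def radPoint (r u ℓ : ℝ) : Phase :=
  (r • (EuclideanSpace.single (0 : Fin 3) (1:ℝ)),
   (Real.sign u * Real.sqrt (r ^ 2 * u ^ 2 - ℓ) / r) • (EuclideanSpace.single (0 : Fin 3) (1:ℝ))
     + (Real.sqrt ℓ / r) • (EuclideanSpace.single (1 : Fin 3) (1:ℝ)))

/-- Distribution function of `f` at kinetic momentum `ℓ`. -/
def muDist (f : Phase → ℝ) (s ℓ : ℝ) : ℝ≥0∞ :=
  nuMeas ℓ {p : ℝ × ℝ | s < f (radPoint p.1 p.2 ℓ)}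

/-- `g ∈ Eq(f)` : `g` is nonnegative, spherically symmetric and equimeasurable to `f`
at (almost) every kinetic momentum `ℓ`. -/
def EqMeas (f g : Phase → ℝ) : Prop :=
  (∀ z, 0 ≤ g z) ∧ SphSym g ∧
    ∀ s : ℝ, 0 < s →
      ∀ᵐ ℓ ∂(volume.restrict (Ioi (0:ℝ))), muDist g s ℓ = muDist f s ℓ

/-- Schwarz symmetrization of `f` at fixed `ℓ`. -/
def schwarz (f : Phase → ℝ) (t ℓ : ℝ) : ℝ :=
  if ENNReal.ofReal t < muDist f 0 ℓ then
    sSup {s : ℝ | 0 ≤ s ∧ ENNReal.ofReal t < muDist f s ℓ}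
  else 0

/-- Effective potential. -/
def psiPot (φ : ℝ → ℝ) (ℓ r : ℝ) : ℝ := φ r + ℓ / (2 * r ^ 2)

def eMinPot (φ : ℝ → ℝ) (ℓ : ℝ) : ℝ := sInf (psiPot φ ℓ '' Ioi 0)

def r1Pot (φ : ℝ → ℝ) (e ℓ : ℝ) : ℝ := sInf {r : ℝ | 0 < r ∧ psiPot φ ℓ r < e}

def r2Pot (φ : ℝ → ℝ) (e ℓ : ℝ) : ℝ := sSup {r : ℝ | 0 < r ∧ psiPot φ ℓ r < e}

/-- The Jacobian `a_φ(e, ℓ)` (meaningful for `e < 0`). -/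
def aPot (φ : ℝ → ℝ) (e ℓ : ℝ) : ℝ :=
  8 * π ^ 2 * Real.sqrt 2 * ∫ r in Ioi (0:ℝ), Real.sqrt (max (e - psiPot φ ℓ r) 0)

/-- Inverse of the bijection `e ↦ a_φ(e,ℓ)` from `(e_{φ,ℓ},0)` onto `(0,∞)`. -/
def aPotInv (φ : ℝ → ℝ) (s ℓ : ℝ) : ℝ :=
  sSup {e : ℝ | eMinPot φ ℓ < e ∧ e < 0 ∧ aPot φ e ℓ < s}

/-- Microscopic energy w.r.t. the Poisson field of `g`. -/
def microE (g : Phase → ℝ) (z : Phase) : ℝ := ‖z.2‖ ^ 2 / 2 + phiF g z.1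

/-- Rearrangement of `f` with respect to the microscopic energy of the field of `g`. -/
def rearr (f g : Phase → ℝ) (z : Phase) : ℝ :=
  if microE g z < 0 then
    schwarz f (aPot (phiRad g) (microE g z) (ellOf z)) (ellOf z)
  else 0

/-- Assumption (A). -/
structure AssumptionA (Q : Phase → ℝ) (F : ℝ → ℝ → ℝ) (e₀ : ℝ) : Prop where
  contQ : Continuous Q
  nonneg : ∀ z, 0 ≤ Q z
  nonzero : Q ≠ 0
  cpt : HasCompactSupport Q
  sph : SphSym Q
  eqF : ∀ z : Phase, Q z = F (microE Q z) (ellOf z)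
  Fnonneg : ∀ e ℓ, 0 ≤ ℓ → 0 ≤ F e ℓ
  Fcont : ContinuousOn (fun p : ℝ × ℝ => F p.1 p.2) {p : ℝ × ℝ | 0 ≤ p.2}
  e₀neg : e₀ < 0
  Fsupp : ∀ e ℓ, 0 ≤ ℓ → 0 < F e ℓ → e < e₀
  FC1 : ContDiffOn ℝ 1 (fun p : ℝ × ℝ => F p.1 p.2) {p : ℝ × ℝ | 0 ≤ p.2 ∧ 0 < F p.1 p.2}
  FeNeg : ∀ e ℓ, 0 ≤ ℓ → 0 < F e ℓ → deriv (fun e' => F e' ℓ) e < 0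

/-- The reduced functional `J_{f^*}(φ_g) = H(f^{*φ_g}) + ½|∇φ_g − ∇φ_{f^{*φ_g}}|²`. -/
def Jred (f g : Phase → ℝ) : ℝ :=
  Ham (rearr f g) + (∫ x : E3, ‖gradPhi g x - gradPhi (rearr f g) x‖ ^ 2) / 2

def distL1 (f g : Phase → ℝ) : ℝ := ∫ z : Phase, |f z - g z|

def distL1v (f g : Phase → ℝ) : ℝ := ∫ z : Phase, ‖z.2‖ ^ 2 * |f z - g z|



abbrev e0 : E3 := EuclideanSpace.single (0 : Fin 3) (1:ℝ)
abbrev e1 : E3 := EuclideanSpace.single (1 : Fin 3) (1:ℝ)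
abbrev e2 : E3 := EuclideanSpace.single (2 : Fin 3) (1:ℝ)

lemma det_refl_aux (w : E3) (hw : w ≠ 0) :
    LinearMap.det (((ℝ ∙ w)ᗮ.reflection).toLinearEquiv : E3 →ₗ[ℝ] E3) = -1 := by
  have := Submodule.det_reflection (𝕜 := ℝ) ((ℝ ∙ w)ᗮ)
  rw [Submodule.orthogonal_orthogonal, finrank_span_singleton hw] at this
  simpa using this

/-- rotation carrying `(p, q)`, both orthogonal to `e2`, with a reflection. -/
lemma rot_aux (p w : E3) (hp : inner ℝ e2 p = 0) (h : ‖p‖ = ‖w‖) :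
    ∃ R : E3 ≃ₗᵢ[ℝ] E3, LinearMap.det (R.toLinearEquiv : E3 →ₗ[ℝ] E3) = 1 ∧
      R p = w ∧ ∀ q, inner ℝ e2 q = 0 → inner ℝ (p - w) q = 0 → R q = q := by
  by_cases hpw : p = w
  · refine ⟨LinearIsometryEquiv.refl ℝ E3, ?_, by simpa using hpw, fun q _ _ => rfl⟩
    have : (((LinearIsometryEquiv.refl ℝ E3).toLinearEquiv : E3 ≃ₗ[ℝ] E3) : E3 →ₗ[ℝ] E3) = LinearMap.id := rfl
    rw [this, LinearMap.det_id]
  · have h2 : ∀ q, inner ℝ e2 q = 0 → (ℝ ∙ e2)ᗮ.reflection q = q := by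
      intro q hq
      exact Submodule.reflection_mem_subspace_eq_self
        (Submodule.mem_orthogonal_singleton_iff_inner_right.2 hq)
    refine ⟨((ℝ ∙ e2)ᗮ.reflection).trans ((ℝ ∙ (p - w))ᗮ.reflection), ?_, ?_, ?_⟩
    · have : (((((ℝ ∙ e2)ᗮ.reflection).trans ((ℝ ∙ (p - w))ᗮ.reflection)).toLinearEquiv : E3 ≃ₗ[ℝ] E3) : E3 →ₗ[ℝ] E3)
        = (((ℝ ∙ (p-w))ᗮ.reflection).toLinearEquiv : E3 →ₗ[ℝ] E3) ∘ₗ (((ℝ ∙ e2)ᗮ.reflection).toLinearEquiv : E3 →ₗ[ℝ] E3) := rfl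
      rw [this, LinearMap.det_comp, det_refl_aux _ (sub_ne_zero.2 hpw), det_refl_aux _ (by simp)]
      norm_num
    · rw [LinearIsometryEquiv.trans_apply, h2 p hp]
      exact Submodule.reflection_sub h
    · intro q hq hq'
      rw [LinearIsometryEquiv.trans_apply, h2 q hq]
      exact Submodule.reflection_mem_subspace_eq_self
        (Submodule.mem_orthogonal_singleton_iff_inner_right.2 hq')

/-- invariance for `ℝ≥0∞`-valued functions -/
def RotInv (h : Phase → ℝ≥0∞) : Prop :=
  ∀ R : E3 ≃ₗᵢ[ℝ] E3, LinearMap.det (R.toLinearEquiv : E3 →ₗ[ℝ] E3) = 1 →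
    ∀ z : Phase, h (R z.1, R z.2) = h z

lemma inner_e2_e0 : inner ℝ e2 e0 = (0:ℝ) := by
  simp [EuclideanSpace.inner_single_left]
lemma inner_e2_e1 : inner ℝ e2 e1 = (0:ℝ) := by
  simp [EuclideanSpace.inner_single_left]

lemma step1 (h : Phase → ℝ≥0∞) (hi : RotInv h) (x : E3) :
    ∫⁻ v, h (x, v) = ∫⁻ v, h (‖x‖ • e0, v) := by
  obtain ⟨R, hR, hRx, -⟩ := rot_aux (‖x‖ • e0) x (by rw [inner_smul_right, inner_e2_e0, mul_zero]) (by simp [norm_smul])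
  rw [← (R.measurePreserving).lintegral_comp_emb R.toMeasurableEquiv.measurableEmbedding]
  refine lintegral_congr fun v => ?_
  have := hi R hR (‖x‖ • e0, v)
  simp only [hRx] at this
  exact this

lemma lintegral_norm_E3 (φ : ℝ → ℝ≥0∞) (hφ : Measurable φ) :
    ∫⁻ x : E3, φ ‖x‖ = ENNReal.ofReal (4 * π) * ∫⁻ r in Ioi (0:ℝ), ENNReal.ofReal (r ^ 2) * φ r :=
  have hd : Module.finrank ℝ E3 = 3 := by simp
  calc
    ∫⁻ x : E3, φ ‖x‖ = ∫⁻ x : ({(0)}ᶜ : Set E3), φ (‖x.1‖) ∂((volume : Measure E3).comap Subtype.val) := by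
      rw [lintegral_subtype_comap (measurableSet_singleton _).compl fun x : E3 ↦ φ (‖x‖),
        restrict_compl_singleton]
    _ = ∫⁻ x, φ x.2 ∂(volume : Measure E3).toSphere.prod (.volumeIoiPow (Module.finrank ℝ E3 - 1)) := by
      simpa using ((volume : Measure E3).measurePreserving_homeomorphUnitSphereProd).lintegral_comp_emb
        (Homeomorph.measurableEmbedding _) (φ ∘ Subtype.val ∘ Prod.snd)
    _ = (volume : Measure E3).toSphere univ * ∫⁻ x : Ioi (0 : ℝ), φ x ∂.volumeIoiPow (Module.finrank ℝ E3 - 1) := by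
      rw [lintegral_prod _ (by fun_prop)]
      simp [lintegral_const, mul_comm]
    _ = _ := by
      rw [Measure.toSphere_apply_univ, EuclideanSpace.volume_ball_fin_three, hd, Measure.volumeIoiPow,
        lintegral_withDensity_eq_lintegral_mul _ (by fun_prop) (by fun_prop)]
      have := lintegral_subtype_comap (μ := volume) (measurableSet_Ioi (a := (0:ℝ)))
        fun a : ℝ ↦ ENNReal.ofReal (a ^ 2) * φ a
      simp only [Pi.mul_apply]
      rw [this]
      congr 1
      rw [show ((3:ℕ):ℝ≥0∞) = ENNReal.ofReal 3 by simp, ← ENNReal.ofReal_pow (by norm_num), ← ENNReal.ofReal_mul (by norm_num),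
        ← ENNReal.ofReal_mul (by positivity)]
      congr 1; ring

lemma lintegral_E3 (φ : E3 → ℝ≥0∞) (hφ : Measurable φ) :
    ∫⁻ v, φ v = ∫⁻ a : ℝ, ∫⁻ p : ℝ × ℝ, φ !₂[a, p.1, p.2] := by
  have h1 := (EuclideanSpace.volume_preserving_symm_measurableEquiv_toLp (Fin 3)).symm
  have h2 := (volume_preserving_piFinSuccAbove (fun _ : Fin 3 => ℝ) 0).symm
  have h3 := (volume_preserving_finTwoArrow ℝ).symm
  rw [← h1.lintegral_comp_emb (MeasurableEquiv.measurableEmbedding _),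
    ← h2.lintegral_comp_emb (MeasurableEquiv.measurableEmbedding _), Measure.volume_eq_prod, lintegral_prod]
  · refine lintegral_congr fun a => ?_
    rw [← h3.lintegral_comp_emb (MeasurableEquiv.measurableEmbedding _)]
    refine lintegral_congr fun p => ?_
    congr 1
    ext i
    fin_cases i <;> rfl
  · exact (hφ.comp ((MeasurableEquiv.measurable _).comp (MeasurableEquiv.measurable _))).aemeasurable

lemma lintegral_polar_const (φ : ℝ × ℝ → ℝ≥0∞) (hφ : Measurable φ)
    (hr : ∀ b > 0, ∀ θ : ℝ, φ (b * cos θ, b * sin θ) = φ (b, 0)) :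
    ∫⁻ p, φ p = ENNReal.ofReal (2 * π) * ∫⁻ b in Ioi (0:ℝ), ENNReal.ofReal b * φ (b, 0) := by
  rw [← lintegral_comp_polarCoord_symm, polarCoord_target, Measure.volume_eq_prod,
    ← Measure.prod_restrict, lintegral_prod _ (by fun_prop), mul_comm,
    ← lintegral_mul_const _ (by fun_prop)]
  refine setLIntegral_congr_fun measurableSet_Ioi fun b hb => ?_
  simp only [polarCoord_symm_apply, hr b hb]
  simp [two_mul]

lemma step2 (h : Phase → ℝ≥0∞) (hm : Measurable h) (hi : RotInv h) (r : ℝ) :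
    ∫⁻ v, h (r • e0, v) = ENNReal.ofReal (2 * π) *
      ∫⁻ a : ℝ, ∫⁻ b in Ioi (0:ℝ), ENNReal.ofReal b * h (r • e0, a • e0 + b • e1) := by
  rw [lintegral_E3 _ (by fun_prop), ← lintegral_const_mul']
  swap; · exact ENNReal.ofReal_ne_top
  refine lintegral_congr fun a => ?_
  have hm1 : Measurable fun p : ℝ × ℝ => (r • e0, !₂[a, p.1, p.2]) := by
    refine measurable_const.prodMk ?_
    exact (MeasurableEquiv.toLp 2 (Fin 3 → ℝ)).measurable.comp (by
      rw [measurable_pi_iff]; intro i; fin_cases i <;> simp <;> fun_prop)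
  have key : ∀ b : ℝ, (!₂[a, b, 0] : E3) = a • e0 + b • e1 := by
    intro b; ext i; fin_cases i <;> simp
  rw [lintegral_polar_const (fun p => h (r • e0, !₂[a, p.1, p.2])) (hm.comp hm1)]
  · simp only [key]
  · intro b hb θ
    obtain ⟨R, hR, hRx, hq⟩ := rot_aux (b • e1) (!₂[0, b * cos θ, b * sin θ]) (by rw [inner_smul_right, inner_e2_e1, mul_zero]) (by
      simp [norm_smul, EuclideanSpace.norm_eq, Fin.sum_univ_three, abs_of_pos hb]
      rw [show (b * cos θ)^2 + (b * sin θ)^2 = b^2 * (cos θ^2 + sin θ^2) by ring]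
      simp [Real.sqrt_sq hb.le])
    have h0 : R e0 = e0 := hq e0 inner_e2_e0 (by simp [inner_sub_left, PiLp.inner_apply])
    have := hi R hR (r • e0, a • e0 + b • e1)
    simp only [map_add, hRx, map_smul R, h0] at this
    simp only [key]
    rw [← this]
    congr 2
    ext i; fin_cases i <;> simp

lemma subst_ell (r : ℝ) (hr : 0 < r) (F : ℝ → ℝ≥0∞) :
    ∫⁻ b in Ioi (0:ℝ), ENNReal.ofReal b * F b
      = ∫⁻ l in Ioi (0:ℝ), ENNReal.ofReal (1 / (2 * r ^ 2)) * F (√l / r) := by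
  have him : (fun l : ℝ => √l / r) '' Ioi 0 = Ioi 0 := by
    ext b
    constructor
    · rintro ⟨l, hl, rfl⟩
      exact div_pos (Real.sqrt_pos.2 hl) hr
    · intro hb
      have hb' : 0 < b := hb
      refine ⟨(b * r) ^ 2, by simp only [mem_Ioi]; positivity, ?_⟩
      simp only
      rw [Real.sqrt_sq (by positivity)]
      field_simp
  have hinj : InjOn (fun l : ℝ => √l / r) (Ioi 0) := by
    intro x hx y hy hxy
    have hx' : (0:ℝ) < x := hx
    have hy' : (0:ℝ) < y := hy
    simp only at hxy
    rw [div_left_inj' hr.ne'] at hxy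
    exact (Real.sqrt_inj hx'.le hy'.le).1 hxy
  have hder : ∀ l ∈ Ioi (0:ℝ), HasDerivWithinAt (fun l : ℝ => √l / r) (1 / (2 * √l) / r) (Ioi 0) l := by
    intro l hl
    have hl' : (0:ℝ) < l := hl
    exact ((Real.hasDerivAt_sqrt hl'.ne').div_const r).hasDerivWithinAt
  have := lintegral_image_eq_lintegral_abs_deriv_mul measurableSet_Ioi hder hinj
    (fun b => ENNReal.ofReal b * F b)
  rw [him] at this
  rw [this]
  refine setLIntegral_congr_fun measurableSet_Ioi fun l hl => ?_
  have hl' : (0:ℝ) < l := hl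
  have hs : 0 < √l := Real.sqrt_pos.2 hl'
  rw [← mul_assoc, ← ENNReal.ofReal_mul (abs_nonneg _), abs_of_pos (by positivity)]
  congr 2
  field_simp

lemma subst_a (r l : ℝ) (hr : 0 < r) (hl : 0 < l) (F : ℝ → ℝ≥0∞) :
    ∫⁻ a : ℝ, F a = ∫⁻ u in {u : ℝ | l < r ^ 2 * u ^ 2},
      ENNReal.ofReal (r * |u| / √(r ^ 2 * u ^ 2 - l)) *
        F (Real.sign u * √(r ^ 2 * u ^ 2 - l) / r) := by
  set S : Set ℝ := {u : ℝ | l < r ^ 2 * u ^ 2} with hS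
  set A : ℝ → ℝ := fun u => Real.sign u * √(r ^ 2 * u ^ 2 - l) / r with hA
  have hSo : IsOpen S := isOpen_lt continuous_const (by fun_prop)
  have hne : ∀ u ∈ S, u ≠ 0 := by
    rintro u hu rfl
    simp [hS] at hu; linarith
  have hpos : ∀ u ∈ S, 0 < √(r ^ 2 * u ^ 2 - l) := fun u hu => Real.sqrt_pos.2 (sub_pos.2 hu)
  have hder : ∀ u ∈ S, HasDerivWithinAt A
      (Real.sign u * (r ^ 2 * (2 * u) / (2 * √(r ^ 2 * u ^ 2 - l))) / r) S u := by
    intro u hu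
    have h1 : HasDerivAt (fun u : ℝ => r ^ 2 * u ^ 2 - l) (r ^ 2 * (2 * u)) u := by
      have := ((hasDerivAt_pow 2 u).const_mul (r ^ 2)).sub_const l
      simpa using this
    have h2 := ((h1.sqrt (sub_pos.2 hu).ne').const_mul (Real.sign u)).div_const r
    refine (h2.congr_of_eventuallyEq ?_).hasDerivWithinAt
    have : ∀ᶠ w in 𝓝 u, Real.sign w = Real.sign u := by
      rcases lt_or_gt_of_ne (hne u hu) with h | h
      · filter_upwards [Iio_mem_nhds h] with w hw
        rw [Real.sign_of_neg h, Real.sign_of_neg hw]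
      · filter_upwards [Ioi_mem_nhds h] with w hw
        rw [Real.sign_of_pos h, Real.sign_of_pos hw]
    filter_upwards [this] with w hw
    simp only [hA, hw]
  have hsgn : ∀ u ∈ S, Real.sign (A u) = Real.sign u := by
    intro u hu
    have hp := hpos u hu
    rcases lt_or_gt_of_ne (hne u hu) with h | h
    · rw [Real.sign_of_neg h]
      apply Real.sign_of_neg
      simp only [hA, Real.sign_of_neg h]
      have : 0 < √(r ^ 2 * u ^ 2 - l) / r := by positivity
      rw [mul_div_assoc]; linarith
    · rw [Real.sign_of_pos h]
      apply Real.sign_of_pos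
      simp only [hA, Real.sign_of_pos h]
      positivity
  have hss : ∀ u : ℝ, u ≠ 0 → Real.sign u ^ 2 = 1 := by
    intro u hu
    rcases lt_or_gt_of_ne hu with h | h
    · rw [Real.sign_of_neg h]; norm_num
    · rw [Real.sign_of_pos h]; norm_num
  have hsq : ∀ u ∈ S, A u ^ 2 = u ^ 2 - l / r ^ 2 := by
    intro u hu
    simp only [hA]
    rw [div_pow, mul_pow, hss u (hne u hu), Real.sq_sqrt (sub_pos.2 hu).le]
    field_simp
  have habs : ∀ u : ℝ, u ≠ 0 → u = Real.sign u * |u| := by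
    intro u hu
    rcases lt_or_gt_of_ne hu with h | h
    · rw [Real.sign_of_neg h, abs_of_neg h]; ring
    · rw [Real.sign_of_pos h, abs_of_pos h]; ring
  have hinj : InjOn A S := by
    intro x hx y hy hxy
    have h1 := hsgn x hx
    rw [hxy, hsgn y hy] at h1
    have h2 := hsq x hx
    rw [hxy, hsq y hy] at h2
    have h3 : |x| = |y| := (sq_eq_sq_iff_abs_eq_abs x y).1 (by linarith)
    rw [habs x (hne x hx), habs y (hne y hy), h1, h3]
  have him : A '' S = {0}ᶜ := by
    ext a
    constructor
    · rintro ⟨u, hu, rfl⟩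
      have hp := hpos u hu
      have : Real.sign u ≠ 0 := by
        intro h0
        have := hss u (hne u hu)
        rw [h0] at this; norm_num at this
      simp only [mem_compl_iff, mem_singleton_iff, hA]
      exact div_ne_zero (mul_ne_zero this hp.ne') hr.ne'
    · intro ha
      have ha : a ≠ 0 := ha
      have hq : 0 < a ^ 2 + l / r ^ 2 := by positivity
      have hu2 : (Real.sign a * √(a ^ 2 + l / r ^ 2)) ^ 2 = a ^ 2 + l / r ^ 2 := by
        rw [mul_pow, hss a ha, Real.sq_sqrt hq.le, one_mul]
      have hr2 : r ^ 2 * (a ^ 2 + l / r ^ 2) - l = (r * |a|) ^ 2 := by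
        rw [mul_pow, sq_abs]; field_simp; ring
      refine ⟨Real.sign a * √(a ^ 2 + l / r ^ 2), ?_, ?_⟩
      · simp only [hS, mem_ofPred_eq, hu2]
        have : 0 < (r * |a|) ^ 2 := by positivity
        linarith
      · have hsg : Real.sign (Real.sign a * √(a ^ 2 + l / r ^ 2)) = Real.sign a := by
          have := Real.sqrt_pos.2 hq
          rcases lt_or_gt_of_ne ha with h | h
          · rw [Real.sign_of_neg h, Real.sign_of_neg (by linarith)]
          · rw [Real.sign_of_pos h, Real.sign_of_pos (by linarith)]
        simp only [hA]
        rw [hu2, hsg, hr2, Real.sqrt_sq (by positivity)]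
        conv_rhs => rw [habs a ha]
        field_simp
  have := lintegral_image_eq_lintegral_abs_deriv_mul hSo.measurableSet hder hinj F
  rw [him, restrict_compl_singleton] at this
  rw [this]
  refine setLIntegral_congr_fun hSo.measurableSet fun u hu => ?_
  have hp := hpos u hu
  congr 2
  rw [abs_div, abs_mul, abs_div, abs_mul, abs_mul, abs_mul, abs_of_pos hr, abs_of_pos hp, abs_of_pos (by positivity : 0 < r^2)]
  have : |Real.sign u| = 1 := by
    have h1 := hss u (hne u hu)
    rw [← sq_abs] at h1
    exact (pow_eq_one_iff_of_nonneg (abs_nonneg _) two_ne_zero).1 h1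
  rw [this, abs_two]
  field_simp

lemma measurable_sign : Measurable Real.sign := by
  unfold Real.sign
  exact Measurable.ite measurableSet_Iio measurable_const
    (Measurable.ite measurableSet_Ioi measurable_const measurable_const)

lemma measurable_radPoint : Measurable fun q : ℝ × ℝ × ℝ => radPoint q.2.1 q.2.2 q.1 := by
  unfold radPoint
  have := measurable_sign
  fun_prop

lemma measurable_nuDens : Measurable fun q : ℝ × ℝ × ℝ => nuDens q.1 q.2 := by
  unfold nuDens
  refine Measurable.ite ?_ (by fun_prop) measurable_const
  have h1 : Measurable fun q : ℝ × ℝ × ℝ => q.2.1 := by fun_prop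
  have h2 : Measurable fun q : ℝ × ℝ × ℝ => q.2.1 ^ 2 * q.2.2 ^ 2 := by fun_prop
  exact (measurableSet_lt measurable_const h1).inter (measurableSet_lt measurable_fst h2)

lemma key_formula (h : Phase → ℝ≥0∞) (hm : Measurable h) (hi : RotInv h) :
    ∫⁻ z, h z = ∫⁻ l in Ioi (0:ℝ), ∫⁻ p, nuDens l p * h (radPoint p.1 p.2 l) := by
  have hmj : Measurable fun q : ℝ × ℝ × ℝ => h (q.1 • e0, q.2.1 • e0 + q.2.2 • e1) := by
    fun_prop
  have hmr : Measurable fun q : ℝ × ℝ × ℝ => nuDens q.1 q.2 * h (radPoint q.2.1 q.2.2 q.1) :=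
    measurable_nuDens.mul (hm.comp measurable_radPoint)
  have hΦ : Measurable fun r : ℝ => ∫⁻ v, h (r • e0, v) := by
    apply Measurable.lintegral_prod_right' (f := fun q : ℝ × E3 => h (q.1 • e0, q.2))
    fun_prop
  rw [Measure.volume_eq_prod, lintegral_prod _ hm.aemeasurable]
  rw [lintegral_congr (step1 h hi)]
  rw [lintegral_norm_E3 (fun r => ∫⁻ v, h (r • e0, v)) hΦ, ← lintegral_const_mul' _ _ ENNReal.ofReal_ne_top]
  have hR : ∀ l, ∫⁻ p, nuDens l p * h (radPoint p.1 p.2 l)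
      = ∫⁻ r in Ioi (0:ℝ), ∫⁻ u, nuDens l (r, u) * h (radPoint r u l) := by
    intro l
    rw [Measure.volume_eq_prod, lintegral_prod _ (by
      exact (hmr.comp (measurable_const.prodMk measurable_id)).aemeasurable),
      ← lintegral_indicator measurableSet_Ioi]
    refine lintegral_congr fun r => ?_
    by_cases hr : 0 < r
    · rw [indicator_of_mem (by exact hr)]
    · rw [indicator_of_notMem (by exact hr)]
      simp [nuDens, hr]
  simp_rw [hR]
  rw [lintegral_lintegral_swap]
  swap
  · apply Measurable.aemeasurable
    apply Measurable.lintegral_prod_right' (f := fun q : (ℝ × ℝ) × ℝ => nuDens q.1.1 (q.1.2, q.2) * h (radPoint q.1.2 q.2 q.1.1))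
    exact hmr.comp (by fun_prop : Measurable fun q : (ℝ × ℝ) × ℝ => (q.1.1, q.1.2, q.2))
  refine setLIntegral_congr_fun measurableSet_Ioi fun r hr => ?_
  have hr : 0 < r := hr
  rw [step2 h hm hi]
  have e1' : ∀ a : ℝ, ∫⁻ b in Ioi (0:ℝ), ENNReal.ofReal b * h (r • e0, a • e0 + b • e1)
      = ∫⁻ l in Ioi (0:ℝ), ENNReal.ofReal (1 / (2 * r ^ 2)) * h (r • e0, a • e0 + (√l / r) • e1) :=
    fun a => subst_ell r hr (fun b => h (r • e0, a • e0 + b • e1))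
  simp_rw [e1']
  rw [lintegral_lintegral_swap (by
    apply Measurable.aemeasurable
    fun_prop), ← mul_assoc, ← mul_assoc, ← lintegral_const_mul' _ _ (by finiteness)]
  refine setLIntegral_congr_fun measurableSet_Ioi fun l hl => ?_
  have hl : 0 < l := hl
  rw [lintegral_const_mul' _ _ ENNReal.ofReal_ne_top, ← mul_assoc, ← ENNReal.ofReal_mul (by positivity),
    ← ENNReal.ofReal_mul (by positivity), ← ENNReal.ofReal_mul (by positivity),
    subst_a r l hr hl (fun a => h (r • e0, a • e0 + (√l / r) • e1)),
    ← lintegral_const_mul' _ _ ENNReal.ofReal_ne_top,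
    ← lintegral_indicator (measurableSet_lt measurable_const (by fun_prop))]
  refine lintegral_congr fun u => ?_
  by_cases hu : l < r ^ 2 * u ^ 2
  · rw [indicator_of_mem (by exact hu)]
    simp only [nuDens, hr, hu, and_self, if_true, radPoint]
    rw [← mul_assoc, ← ENNReal.ofReal_mul (by positivity)]
    congr 2
    field_simp
  · rw [indicator_of_notMem (by exact hu)]
    simp [nuDens, hu]

lemma ellOf_radPoint (r u l : ℝ) (hr : 0 < r) (hl : 0 < l) (_hu : l < r ^ 2 * u ^ 2) :
    ellOf (radPoint r u l) = l := by
  have hn : ∀ a b : ℝ, ‖a • e0 + b • e1‖ ^ 2 = a ^ 2 + b ^ 2 := by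
    intro a b
    rw [EuclideanSpace.norm_sq_eq]
    simp [Fin.sum_univ_three]
  have hin : ∀ a b : ℝ, inner ℝ (r • e0) (a • e0 + b • e1) = r * a := by
    intro a b
    rw [PiLp.inner_apply]
    simp [mul_comm]
  unfold ellOf radPoint
  simp only
  rw [hn, hin, norm_smul]
  have : (√l / r) ^ 2 = l / r ^ 2 := by rw [div_pow, Real.sq_sqrt hl.le]
  rw [this]
  simp
  field_simp
  ring

lemma measurable_ellOf : Measurable ellOf := by
  unfold ellOf; fun_prop

lemma ellOf_nonneg (z : Phase) : 0 ≤ ellOf z := by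
  unfold ellOf
  have h1 := abs_real_inner_le_norm z.1 z.2
  have h2 : (inner ℝ z.1 z.2) ^ 2 ≤ (‖z.1‖ * ‖z.2‖) ^ 2 := by
    rw [← sq_abs]; gcongr
  rw [mul_pow] at h2; linarith

lemma ellOf_rot (R : E3 ≃ₗᵢ[ℝ] E3) (z : Phase) : ellOf (R z.1, R z.2) = ellOf z := by
  simp [ellOf]

lemma muDist_eq (f : Phase → ℝ) (hf : Measurable f) (s l : ℝ) :
    muDist f s l = ∫⁻ p, nuDens l p * (if s < f (radPoint p.1 p.2 l) then 1 else 0) := by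
  have hrp : Measurable fun p : ℝ × ℝ => f (radPoint p.1 p.2 l) :=
    hf.comp (measurable_radPoint.comp (measurable_const.prodMk measurable_id))
  have hS : MeasurableSet {p : ℝ × ℝ | s < f (radPoint p.1 p.2 l)} :=
    measurableSet_lt measurable_const hrp
  unfold muDist nuMeas
  rw [withDensity_apply _ hS, ← lintegral_indicator hS]
  refine lintegral_congr fun p => ?_
  by_cases h : s < f (radPoint p.1 p.2 l)
  · rw [indicator_of_mem (by exact h)]; simp [h]
  · rw [indicator_of_notMem (by exact h)]; simp [h]

lemma measurable_muDist (f : Phase → ℝ) (hf : Measurable f) (s : ℝ) :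
    Measurable (muDist f s) := by
  have : muDist f s = fun l => ∫⁻ p, nuDens l p * (if s < f (radPoint p.1 p.2 l) then 1 else 0) :=
    funext fun l => muDist_eq f hf s l
  rw [this]
  apply Measurable.lintegral_prod_right' (f := fun q : ℝ × ℝ × ℝ =>
    nuDens q.1 q.2 * (if s < f (radPoint q.2.1 q.2.2 q.1) then 1 else 0))
  exact measurable_nuDens.mul (Measurable.ite
    (measurableSet_lt measurable_const (hf.comp measurable_radPoint)) measurable_const measurable_const)

lemma dist_formula (f : Phase → ℝ) (hf : Measurable f) (hs : SphSym f) (s : ℝ) (B : Set ℝ)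
    (hB : MeasurableSet B) :
    volume {z : Phase | s < f z ∧ ellOf z ∈ B} =
      ∫⁻ l in B, muDist f s l ∂(volume.restrict (Ioi (0:ℝ))) := by
  have hS : MeasurableSet {z : Phase | s < f z ∧ ellOf z ∈ B} :=
    (measurableSet_lt measurable_const hf).inter (measurable_ellOf hB)
  rw [← lintegral_indicator_one hS, key_formula _ (measurable_one.indicator hS)]
  · rw [← lintegral_indicator hB]
    refine setLIntegral_congr_fun measurableSet_Ioi fun l hl => ?_
    have hl : 0 < l := hl
    have key : ∀ p : ℝ × ℝ, nuDens l p *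
        {z : Phase | s < f z ∧ ellOf z ∈ B}.indicator 1 (radPoint p.1 p.2 l)
        = nuDens l p * ((if s < f (radPoint p.1 p.2 l) then 1 else 0) * B.indicator 1 l) := by
      intro p
      by_cases hp : 0 < p.1 ∧ l < p.1 ^ 2 * p.2 ^ 2
      · congr 1
        have he := ellOf_radPoint _ _ _ hp.1 hl hp.2
        by_cases h1 : s < f (radPoint p.1 p.2 l)
        · by_cases h2 : l ∈ B
          · rw [indicator_of_mem (by exact ⟨h1, by rw [he]; exact h2⟩)]
            simp [h1, h2]
          · rw [indicator_of_notMem (by rintro ⟨-, h⟩; rw [he] at h; exact h2 h)]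
            simp [h2]
        · rw [indicator_of_notMem (by rintro ⟨h, -⟩; exact h1 h)]
          simp [h1]
      · simp [nuDens, hp]
    rw [lintegral_congr key]
    by_cases hlB : l ∈ B
    · simp [hlB, muDist_eq f hf]
    · simp [hlB]
  · intro R hR z
    have : (R z.1, R z.2) ∈ {z : Phase | s < f z ∧ ellOf z ∈ B} ↔
        z ∈ {z : Phase | s < f z ∧ ellOf z ∈ B} := by
      simp only [mem_ofPred_eq, hs R hR z, ellOf_rot]
    by_cases hz : z ∈ {z : Phase | s < f z ∧ ellOf z ∈ B}
    · rw [indicator_of_mem hz, indicator_of_mem (this.2 hz)]; rfl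
    · rw [indicator_of_notMem hz, indicator_of_notMem (fun h => hz (this.1 h))]

lemma eqMeas_iff (f g : Phase → ℝ) (hfm : Measurable f) (hgm : Measurable g)
    (hg0 : ∀ z, 0 ≤ g z) (hfs : SphSym f) (hgs : SphSym g) :
    EqMeas f g ↔ ∀ s : ℝ, 0 < s → ∀ B : Set ℝ, MeasurableSet B →
      volume {z : Phase | s < f z ∧ ellOf z ∈ B} = volume {z : Phase | s < g z ∧ ellOf z ∈ B} := by
  constructor
  · rintro ⟨-, -, h⟩ s hs B hB
    rw [dist_formula f hfm hfs s B hB, dist_formula g hgm hgs s B hB]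
    refine lintegral_congr_ae ?_
    filter_upwards [ae_restrict_of_ae (h s hs)] with l hl using hl.symm
  · intro h
    refine ⟨hg0, hgs, fun s hs => ?_⟩
    refine ae_eq_of_forall_setLIntegral_eq_of_sigmaFinite (measurable_muDist g hgm s)
      (measurable_muDist f hfm s) fun B hB _ => ?_
    rw [← dist_formula f hfm hfs s B hB, ← dist_formula g hgm hgs s B hB, h s hs B hB]

lemma integrable_of_eLpNorm (f : Phase → ℝ) (hfm : Measurable f) (hf1 : eLpNorm f 1 volume < ⊤) :
    Integrable f := memLp_one_iff_integrable.1 ⟨hfm.aestronglyMeasurable, hf1⟩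

def logM (f : Phase → ℝ) : Measure (ℝ × ℝ) :=
  (volume.restrict {z | 0 < f z}).map (fun z => (Real.log (f z), ellOf z))

lemma logM_apply (f : Phase → ℝ) (hfm : Measurable f) (t : ℝ) (B : Set ℝ) (hB : MeasurableSet B) :
    logM f (Ioi t ×ˢ B) = volume {z : Phase | Real.exp t < f z ∧ ellOf z ∈ B} := by
  have := measurable_ellOf
  unfold logM
  rw [Measure.map_apply (by fun_prop) (measurableSet_Ioi.prod hB),
    Measure.restrict_apply' (measurableSet_lt measurable_const hfm)]
  congr 1
  ext z
  simp only [mem_inter_iff, mem_preimage, mem_prod, mem_Ioi, mem_ofPred_eq]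
  constructor
  · rintro ⟨⟨h1, h2⟩, h3⟩
    exact ⟨(Real.lt_log_iff_exp_lt h3).1 h1, h2⟩
  · rintro ⟨h1, h2⟩
    have h3 := (Real.exp_pos t).trans h1
    exact ⟨⟨(Real.lt_log_iff_exp_lt h3).2 h1, h2⟩, h3⟩

lemma logM_eq (f g : Phase → ℝ) (hfm : Measurable f) (hgm : Measurable g)
    (hf1 : eLpNorm f 1 volume < ⊤)
    (h : ∀ s : ℝ, 0 < s → ∀ B : Set ℝ, MeasurableSet B →
      volume {z : Phase | s < f z ∧ ellOf z ∈ B} = volume {z : Phase | s < g z ∧ ellOf z ∈ B}) :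
    logM f = logM g := by
  have hsp : IsCountablySpanning (range (Ioi : ℝ → Set ℝ)) := by
    refine ⟨fun n : ℕ => Ioi (-(n:ℝ)), fun n => mem_range_self _, ?_⟩
    refine iUnion_eq_univ_iff.2 fun x => ?_
    obtain ⟨n, hn⟩ := exists_nat_gt (-x)
    exact ⟨n, by simp only [mem_Ioi]; linarith⟩
  refine Measure.ext_of_generateFrom_of_iUnion
    (image2 (· ×ˢ ·) (range (Ioi : ℝ → Set ℝ)) {B : Set ℝ | MeasurableSet B})
    (fun n : ℕ => Ioi (-(n:ℝ)) ×ˢ univ) ?_ ?_ ?_ ?_ ?_ ?_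
  · symm
    refine generateFrom_eq_prod ?_ (@MeasurableSpace.generateFrom_measurableSet ℝ _) hsp isCountablySpanning_measurableSet
    rw [← borel_eq_generateFrom_Ioi, BorelSpace.measurable_eq (α := ℝ)]
  · refine IsPiSystem.prod ?_ MeasurableSpace.isPiSystem_measurableSet
    exact isPiSystem_Ioi
  · refine iUnion_eq_univ_iff.2 fun x => ?_
    obtain ⟨n, hn⟩ := exists_nat_gt (-x.1)
    exact ⟨n, by simp only [mem_prod, mem_Ioi, mem_univ, and_true]; linarith⟩
  · exact fun n => ⟨_, mem_range_self _, univ, by simp, rfl⟩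
  · intro n
    rw [logM_apply f hfm _ _ MeasurableSet.univ]
    have := (integrable_of_eLpNorm f hfm hf1).measure_gt_lt_top (Real.exp_pos (-(n:ℝ)))
    simpa using this.ne
  · rintro _ ⟨_, ⟨t, rfl⟩, B, hB, rfl⟩
    simp only
    rw [logM_apply f hfm t B hB, logM_apply g hgm t B hB, h _ (Real.exp_pos t) B hB]

lemma integral_logM (f : Phase → ℝ) (hfm : Measurable f) (hf0 : ∀ z, 0 ≤ f z) (G : ℝ → ℝ → ℝ)
    (hG : ContinuousOn (fun p : ℝ × ℝ => G p.1 p.2) {p : ℝ × ℝ | 0 ≤ p.1 ∧ 0 ≤ p.2})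
    (hG0 : ∀ l : ℝ, 0 ≤ l → G 0 l = 0) :
    ∫ z : Phase, G (f z) (ellOf z) = ∫ p, G (Real.exp p.1) (max p.2 0) ∂(logM f) := by
  have := measurable_ellOf
  have hc : Continuous fun p : ℝ × ℝ => G (Real.exp p.1) (max p.2 0) := by
    have h1 : Continuous fun p : ℝ × ℝ => (Real.exp p.1, max p.2 0) := by fun_prop
    exact hG.comp_continuous h1 fun p => ⟨(Real.exp_pos _).le, le_max_right _ _⟩
  unfold logM
  rw [integral_map (by fun_prop) hc.aestronglyMeasurable]
  have h2 : ∫ z in {z | 0 < f z}, G (f z) (ellOf z) = ∫ z : Phase, G (f z) (ellOf z) := by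
    refine setIntegral_eq_integral_of_forall_compl_eq_zero fun z hz => ?_
    have : f z = 0 := le_antisymm (not_lt.1 hz) (hf0 z)
    rw [this, hG0 _ (ellOf_nonneg z)]
  rw [← h2]
  refine setIntegral_congr_fun (measurableSet_lt measurable_const hfm) fun z hz => ?_
  simp only
  rw [Real.exp_log hz, max_eq_left (ellOf_nonneg z)]

def wM (f : Phase → ℝ) : Measure (ℝ × ℝ) :=
  (volume.withDensity (fun z => ENNReal.ofReal (f z))).map (fun z => (f z, ellOf z))

lemma wM_finite (f : Phase → ℝ) (hfm : Measurable f) (hf1 : eLpNorm f 1 volume < ⊤) :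
    IsFiniteMeasure (wM f) := by
  have := measurable_ellOf
  have hI := integrable_of_eLpNorm f hfm hf1
  have : IsFiniteMeasure (volume.withDensity (fun z => ENNReal.ofReal (f z))) :=
    isFiniteMeasure_withDensity_ofReal hI.2
  unfold wM
  infer_instance

lemma wM_recover (f : Phase → ℝ) (hfm : Measurable f) (s : ℝ) (hs : 0 < s)
    (B : Set ℝ) (hB : MeasurableSet B) :
    volume {z : Phase | s < f z ∧ ellOf z ∈ B} =
      ∫⁻ p in Ioi s ×ˢ B, ENNReal.ofReal (1 / p.1) ∂(wM f) := by
  have := measurable_ellOf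
  have hS : MeasurableSet {z : Phase | s < f z ∧ ellOf z ∈ B} :=
    (measurableSet_lt measurable_const hfm).inter (measurable_ellOf hB)
  unfold wM
  rw [setLIntegral_map (measurableSet_Ioi.prod hB) (by fun_prop) (by fun_prop)]
  have hpre : (fun z : Phase => (f z, ellOf z)) ⁻¹' (Ioi s ×ˢ B) = {z : Phase | s < f z ∧ ellOf z ∈ B} := rfl
  rw [hpre, setLIntegral_withDensity_eq_setLIntegral_mul _ (by fun_prop) (by fun_prop) hS,
    ← setLIntegral_one]
  refine setLIntegral_congr_fun hS fun z hz => ?_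
  have : 0 < f z := hs.trans hz.1
  simp only [Pi.mul_apply]
  rw [← ENNReal.ofReal_mul this.le, mul_one_div_cancel this.ne', ENNReal.ofReal_one]

lemma wM_charFun (f : Phase → ℝ) (hfm : Measurable f) (hf0 : ∀ z, 0 ≤ f z)
    (hf1 : eLpNorm f 1 volume < ⊤) (L : StrongDual ℝ (ℝ × ℝ)) :
    charFunDual (wM f) L =
      ((((∫ z, f z * (1 + Real.cos (L (f z, ellOf z)))) - ∫ z, f z : ℝ) : ℂ)) +
      (((∫ z, f z * (1 + Real.sin (L (f z, ellOf z)))) - ∫ z, f z : ℝ) : ℂ) * Complex.I := by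
  have := measurable_ellOf
  have hI := integrable_of_eLpNorm f hfm hf1
  have hLm : Measurable fun z => L (f z, ellOf z) := L.continuous.measurable.comp (by fun_prop)
  have hc : Integrable fun z => f z * Real.cos (L (f z, ellOf z)) := by
    refine hI.mul_bdd (c := 1) (by fun_prop) (ae_of_all _ fun z => ?_)
    exact Real.abs_cos_le_one _
  have hsn : Integrable fun z => f z * Real.sin (L (f z, ellOf z)) := by
    refine hI.mul_bdd (c := 1) (by fun_prop) (ae_of_all _ fun z => ?_)
    exact Real.abs_sin_le_one _
  simp only [mul_add, mul_one]
  rw [integral_add hI hc, integral_add hI hsn, add_sub_cancel_left, add_sub_cancel_left,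
    charFunDual_apply]
  unfold wM
  rw [integral_map (by fun_prop) (by fun_prop),
    integral_withDensity_eq_integral_toReal_smul (by fun_prop) (by simp)]
  rw [← integral_complex_ofReal, ← integral_complex_ofReal, ← integral_mul_const, ← integral_add hc.ofReal (hsn.ofReal.mul_const _)]
  refine integral_congr_ae (ae_of_all _ fun z => ?_)
  simp only
  rw [ENNReal.toReal_ofReal (hf0 z), Complex.exp_mul_I, Complex.real_smul]
  simp
  ring

/-- Lemma: characterization of `Eq(f)` via Casimir functionals. -/
theorem stmt3 (f g : Phase → ℝ)
    (hfm : Measurable f) (hgm : Measurable g)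
    (hf1 : eLpNorm f 1 volume < ⊤) (hfi : eLpNorm f ⊤ volume < ⊤)
    (hg1 : eLpNorm g 1 volume < ⊤) (hgi : eLpNorm g ⊤ volume < ⊤)
    (hf0 : ∀ z, 0 ≤ f z) (hg0 : ∀ z, 0 ≤ g z)
    (hfs : SphSym f) (hgs : SphSym g) :
    EqMeas f g ↔
      ∀ G : ℝ → ℝ → ℝ,
        ContDiffOn ℝ 1 (fun p : ℝ × ℝ => G p.1 p.2) {p : ℝ × ℝ | 0 ≤ p.1 ∧ 0 ≤ p.2} →
        (∀ s ℓ : ℝ, 0 ≤ s → 0 ≤ ℓ → 0 ≤ G s ℓ) →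
        (∀ ℓ : ℝ, 0 ≤ ℓ → G 0 ℓ = 0) →
        (∫ z : Phase, G (f z) (ellOf z)) = ∫ z : Phase, G (g z) (ellOf z) := by
  rw [eqMeas_iff f g hfm hgm hg0 hfs hgs]
  constructor
  · intro h G hG _ hG0
    rw [integral_logM f hfm hf0 G hG.continuousOn hG0, integral_logM g hgm hg0 G hG.continuousOn hG0,
      logM_eq f g hfm hgm hf1 h]
  · intro h s hs B hB
    have := wM_finite f hfm hf1
    have := wM_finite g hgm hg1
    have heq : wM f = wM g := by
      refine Measure.ext_of_charFunDual (funext fun L => ?_)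
      have hL : ContDiff ℝ 1 fun p : ℝ × ℝ => L (p.1, p.2) := by
        have : ContDiff ℝ 1 fun p : ℝ × ℝ => L p := L.contDiff
        exact this
      have h1 := h (fun s _ => s) contDiff_fst.contDiffOn (fun s _ hs _ => hs) (fun _ _ => rfl)
      have h2 := h (fun s l => s * (1 + Real.cos (L (s, l))))
        (contDiff_fst.mul (contDiff_const.add (Real.contDiff_cos.comp hL))).contDiffOn
        (fun s l hs _ => mul_nonneg hs (by linarith [Real.neg_one_le_cos (L (s, l))]))
        (fun _ _ => by simp)
      have h3 := h (fun s l => s * (1 + Real.sin (L (s, l))))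
        (contDiff_fst.mul (contDiff_const.add (Real.contDiff_sin.comp hL))).contDiffOn
        (fun s l hs _ => mul_nonneg hs (by linarith [Real.neg_one_le_sin (L (s, l))]))
        (fun _ _ => by simp)
      rw [wM_charFun f hfm hf0 hf1, wM_charFun g hgm hg0 hg1, h1, h2, h3]
    rw [wM_recover f hfm s hs B hB, wM_recover g hgm s hs B hB, heq]
end
end

section
/- Let f ∈ E_rad be nonzero and φ = φ_f. For each ℓ > 0: ψ_{φ,ℓ} is C¹ on (0,∞); the infimum e_{φ,ℓ} is attained at a unique point r₀(φ,ℓ) > 0; ψ_{φ,ℓ} is strictly decreasing on (0, r₀(φ,ℓ)) and strictly increasing on (r₀(φ,ℓ), ∞); ψ_{φ,ℓ}(r) → +∞ as r → 0⁺ and ψ_{φ,ℓ}(r) → 0 as r → ∞. Moreover the map ℓ ↦ e_{φ,ℓ} is continuous on (0,∞), and for every ℓ > 0 one has max(φ(0), −|f|²_{L¹}/(2ℓ)) ≤ e_{φ,ℓ} < 0. -/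
noncomputable section

open MeasureTheory Real Filter Set Topology
open scoped ENNReal NNReal

/-- cylindrical then spherical coordinates -/
theorem aux_lint (H : ℝ → ℝ → ℝ≥0∞) (hH : Measurable (fun p : ℝ × ℝ => H p.1 p.2)) :
    ∫⁻ y : E3, H (y 0) ‖y‖ = ENNReal.ofReal (2 * π) * ∫⁻ R in Ioi (0:ℝ), ENNReal.ofReal (R ^ 2) *
      ∫⁻ θ in Ioo 0 π, ENNReal.ofReal (sin θ) * H (R * cos θ) R := by
  have e1 : ∫⁻ y : E3, H (y 0) ‖y‖ =
      ∫⁻ p : ℝ × (ℝ × ℝ), H p.1 (√(p.1 ^ 2 + (p.2.1 ^ 2 + p.2.2 ^ 2))) := by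
    have h1 := PiLp.volume_preserving_ofLp (Fin 3)
    have h2 := volume_preserving_piFinSuccAbove (fun _ : Fin 3 => ℝ) 0
    have h3 := (MeasurePreserving.id (volume : Measure ℝ)).prod (volume_preserving_finTwoArrow ℝ)
    have h4 := h3.comp (h2.comp h1)
    rw [← Measure.volume_eq_prod] at h4
    rw [← h4.lintegral_comp (f := fun p : ℝ × (ℝ × ℝ) => H p.1 (√(p.1 ^ 2 + (p.2.1 ^ 2 + p.2.2 ^ 2))))]
    · apply lintegral_congr
      intro y
      rw [EuclideanSpace.norm_eq]
      simp [Fin.sum_univ_three, MeasurableEquiv.piFinSuccAbove, MeasurableEquiv.finTwoArrow, Fin.tail, add_assoc]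
    · exact hH.comp (f := fun p : ℝ × (ℝ × ℝ) => (p.1, √(p.1 ^ 2 + (p.2.1 ^ 2 + p.2.2 ^ 2)))) (by fun_prop)
  have hH' : ∀ {α : Type} [MeasurableSpace α] (a b : α → ℝ), Measurable a → Measurable b →
      Measurable (fun x => H (a x) (b x)) := fun a b ha hb => hH.comp (ha.prodMk hb)
  have e2 : ∀ t : ℝ, ∫⁻ q : ℝ × ℝ, H t (√(t ^ 2 + (q.1 ^ 2 + q.2 ^ 2))) =
      ENNReal.ofReal (2 * π) * ∫⁻ s : ℝ, ENNReal.ofReal s * H t (√(t ^ 2 + s ^ 2)) := by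
    intro t
    rw [← lintegral_comp_polarCoord_symm]
    have : ∀ p : ℝ × ℝ, ENNReal.ofReal p.1 • H t (√(t ^ 2 + ((polarCoord.symm p).1 ^ 2 + (polarCoord.symm p).2 ^ 2)))
        = ENNReal.ofReal p.1 * H t (√(t ^ 2 + p.1 ^ 2)) := by
      intro p
      have : (p.1 * cos p.2) ^ 2 + (p.1 * sin p.2) ^ 2 = p.1 ^ 2 := by
        nlinarith [sin_sq_add_cos_sq p.2]
      simp [this]
    simp_rw [this]
    simp only [polarCoord_target]
    rw [Measure.volume_eq_prod, ← Measure.prod_restrict, lintegral_prod]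
    · simp only [lintegral_const]
      rw [lintegral_mul_const _ (by
        refine Measurable.mul (by fun_prop) (hH' _ _ (by fun_prop) (by fun_prop)))]
      rw [mul_comm]
      congr 1
      · rw [Measure.restrict_apply_univ, Real.volume_Ioo]; congr 1; ring
      · rw [← lintegral_indicator measurableSet_Ioi]
        apply lintegral_congr
        intro s
        by_cases hs : 0 < s
        · simp [hs]
        · simp [hs, ENNReal.ofReal_of_nonpos (not_lt.1 hs)]
    · refine (Measurable.mul (by fun_prop) (hH' _ _ (by fun_prop) (by fun_prop))).aemeasurable
  rw [e1, Measure.volume_eq_prod, lintegral_prod]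
  swap
  · exact (hH' _ _ (by fun_prop) (by fun_prop)).aemeasurable
  simp_rw [e2]
  rw [lintegral_const_mul]
  swap
  · apply Measurable.lintegral_prod_right' (f := fun p : ℝ × ℝ => ENNReal.ofReal p.2 * H p.1 (√(p.1 ^ 2 + p.2 ^ 2)))
    exact Measurable.mul (by fun_prop) (hH' _ _ (by fun_prop) (by fun_prop))
  congr 1
  rw [← lintegral_prod (f := fun p : ℝ × ℝ => ENNReal.ofReal p.2 * H p.1 (√(p.1 ^ 2 + p.2 ^ 2)))]
  swap
  · exact (Measurable.mul (by fun_prop) (hH' _ _ (by fun_prop) (by fun_prop))).aemeasurable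
  rw [← Measure.volume_eq_prod, ← lintegral_comp_polarCoord_symm]
  have : ∀ p ∈ polarCoord.target, ENNReal.ofReal p.1 • (ENNReal.ofReal (polarCoord.symm p).2 *
      H (polarCoord.symm p).1 (√((polarCoord.symm p).1 ^ 2 + (polarCoord.symm p).2 ^ 2)))
        = ENNReal.ofReal (p.1 ^ 2) * (ENNReal.ofReal (sin p.2) * H (p.1 * cos p.2) p.1) := by
      intro p hp
      have hp1 : 0 < p.1 := by simpa using hp.1
      have : (p.1 * cos p.2) ^ 2 + (p.1 * sin p.2) ^ 2 = p.1 ^ 2 := by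
        nlinarith [sin_sq_add_cos_sq p.2]
      simp only [polarCoord_symm_apply, this, Real.sqrt_sq hp1.le, smul_eq_mul]
      rw [ENNReal.ofReal_mul hp1.le, pow_two, ENNReal.ofReal_mul hp1.le]
      ring
  rw [setLIntegral_congr_fun polarCoord.open_target.measurableSet this]
  simp only [polarCoord_target]
  rw [Measure.volume_eq_prod, ← Measure.prod_restrict, lintegral_prod]
  swap
  · refine (Measurable.mul (by fun_prop) (Measurable.mul (by fun_prop) (hH' _ _ (by fun_prop) (by fun_prop)))).aemeasurable
  apply lintegral_congr
  intro R
  simp only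
  rw [lintegral_const_mul]
  swap
  · exact (Measurable.mul (by fun_prop) (hH' _ _ (by fun_prop) (by fun_prop)))
  congr 1
  rw [← lintegral_indicator measurableSet_Ioo, ← lintegral_indicator measurableSet_Ioo]
  apply lintegral_congr
  intro θ
  by_cases h : θ ∈ Ioo 0 π
  · rw [indicator_of_mem h, indicator_of_mem]
    exact ⟨by linarith [h.1, pi_pos], h.2⟩
  · rw [indicator_of_notMem h]
    by_cases h' : θ ∈ Ioo (-π) π
    · rw [indicator_of_mem h', ENNReal.ofReal_of_nonpos, zero_mul]
      have : θ ≤ 0 := by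
        by_contra hc
        exact h ⟨not_le.1 hc, h'.2⟩
      exact sin_nonpos_of_nonpos_of_neg_pi_le this h'.1.le
    · rw [indicator_of_notMem h']

theorem aux_theta (r R : ℝ) (hr : 0 < r) (hR : 0 < R) :
    ∫⁻ θ in Ioo 0 π, ENNReal.ofReal (sin θ) * ENNReal.ofReal (1 / √(r ^ 2 + R ^ 2 - 2 * r * (R * cos θ)))
      = ENNReal.ofReal (2 / max r R) := by
  have hpos : ∀ θ ∈ Ioo 0 π, 0 < r ^ 2 + R ^ 2 - 2 * r * (R * cos θ) := by
    intro θ hθ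
    have h1 : cos θ < 1 := by
      have := cos_lt_cos_of_nonneg_of_le_pi (le_refl 0) hθ.2.le hθ.1
      simpa using this
    have : 0 < r * R := by positivity
    nlinarith [sq_nonneg (r - R)]
  have hderiv : ∀ θ ∈ Ioo 0 π, HasDerivAt (fun θ => √(r ^ 2 + R ^ 2 - 2 * r * (R * cos θ)) / (r * R))
      (sin θ * (1 / √(r ^ 2 + R ^ 2 - 2 * r * (R * cos θ)))) θ := by
    intro θ hθ
    have h1 : HasDerivAt (fun θ => r ^ 2 + R ^ 2 - 2 * r * (R * cos θ)) (2 * r * (R * sin θ)) θ := by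
      have := (((hasDerivAt_cos θ).const_mul R).const_mul (2 * r)).const_sub (r ^ 2 + R ^ 2)
      refine this.congr_deriv ?_
      ring
    have h2 := (h1.sqrt (hpos θ hθ).ne').div_const (r * R)
    refine h2.congr_deriv ?_
    have := Real.sqrt_pos.2 (hpos θ hθ)
    field_simp
  have hnn : ∀ θ ∈ Ioo 0 π, 0 ≤ sin θ * (1 / √(r ^ 2 + R ^ 2 - 2 * r * (R * cos θ))) := by
    intro θ hθ
    have := (sin_pos_of_mem_Ioo hθ).le
    positivity
  have hcont : ContinuousOn (fun θ => √(r ^ 2 + R ^ 2 - 2 * r * (R * cos θ)) / (r * R)) (Icc 0 π) := by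
    fun_prop
  have hint := intervalIntegral.integrableOn_deriv_of_nonneg hcont hderiv hnn
  have hftc := intervalIntegral.integral_eq_sub_of_hasDerivAt_of_le pi_pos.le hcont hderiv
    ((intervalIntegrable_iff_integrableOn_Ioc_of_le pi_pos.le).2 hint)
  rw [intervalIntegral.integral_of_le pi_pos.le, integral_Ioc_eq_integral_Ioo] at hftc
  have h3 : ∫⁻ θ in Ioo 0 π, ENNReal.ofReal (sin θ) * ENNReal.ofReal (1 / √(r ^ 2 + R ^ 2 - 2 * r * (R * cos θ)))
     = ∫⁻ θ in Ioo 0 π, ENNReal.ofReal (sin θ * (1 / √(r ^ 2 + R ^ 2 - 2 * r * (R * cos θ)))) := by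
    apply setLIntegral_congr_fun measurableSet_Ioo
    intro θ hθ
    simp only
    rw [ENNReal.ofReal_mul (sin_pos_of_mem_Ioo hθ).le]
  rw [h3, ← ofReal_integral_eq_lintegral_ofReal (hint.mono_set Ioo_subset_Ioc_self)
    ((ae_restrict_iff' measurableSet_Ioo).2 (Eventually.of_forall hnn)), hftc]
  congr 1
  have a1 : r ^ 2 + R ^ 2 - 2 * r * (R * cos π) = (r + R) ^ 2 := by simp; ring
  have a2 : r ^ 2 + R ^ 2 - 2 * r * (R * cos 0) = (r - R) ^ 2 := by simp; ring
  rw [a1, a2, Real.sqrt_sq (by positivity), Real.sqrt_sq_eq_abs]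
  rcases le_total r R with h | h
  · rw [max_eq_right h, abs_of_nonpos (by linarith)]; field_simp; ring
  · rw [max_eq_left h, abs_of_nonneg (by linarith)]; field_simp; ring

theorem aux_shell (g : ℝ → ℝ≥0∞) (hg : Measurable g) (r : ℝ) (hr : 0 ≤ r) :
    ∫⁻ y : E3, g ‖y‖ * ENNReal.ofReal (1 / ‖r • (EuclideanSpace.single (0 : Fin 3) (1:ℝ)) - y‖) =
    ∫⁻ y : E3, g ‖y‖ * ENNReal.ofReal (1 / max r ‖y‖) := by
  rcases hr.eq_or_lt with rfl | hr
  · apply lintegral_congr; intro y; simp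
  have h1 : ∀ y : E3, ‖r • (EuclideanSpace.single (0 : Fin 3) (1:ℝ)) - y‖ =
      √(r ^ 2 + ‖y‖ ^ 2 - 2 * r * y 0) := by
    intro y
    rw [EuclideanSpace.norm_eq, EuclideanSpace.real_norm_sq_eq]
    congr 1
    simp [Fin.sum_univ_three]
    ring
  simp_rw [h1]
  rw [aux_lint (fun t R => g R * ENNReal.ofReal (1 / √(r ^ 2 + R ^ 2 - 2 * r * t))) (by fun_prop),
    aux_lint (fun t R => g R * ENNReal.ofReal (1 / max r R)) (by fun_prop)]
  congr 1
  apply setLIntegral_congr_fun measurableSet_Ioi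
  intro R hR
  have hR : 0 < R := hR
  simp only
  congr 1
  simp_rw [mul_left_comm (ENNReal.ofReal (sin _))]
  rw [lintegral_const_mul _ (by fun_prop), lintegral_const_mul _ (by fun_prop), aux_theta r R hr hR,
    lintegral_mul_const _ (by fun_prop)]
  congr 1
  have : ∫⁻ θ in Ioo 0 π, ENNReal.ofReal (sin θ) = ENNReal.ofReal 2 := by
    rw [← ofReal_integral_eq_lintegral_ofReal, ← integral_Ioc_eq_integral_Ioo,
      ← intervalIntegral.integral_of_le pi_pos.le, integral_sin]
    · simp; norm_num
    · exact (continuous_sin.integrableOn_Icc).mono_set Ioo_subset_Icc_self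
    · exact (ae_restrict_iff' measurableSet_Ioo).2 (Eventually.of_forall fun θ hθ => (sin_pos_of_mem_Ioo hθ).le)
  rw [this, ← ENNReal.ofReal_mul (by norm_num)]
  congr 1
  ring

theorem aux_rot (x : E3) : ∃ R : E3 ≃ₗᵢ[ℝ] E3, LinearMap.det (R.toLinearEquiv : E3 →ₗ[ℝ] E3) = 1 ∧
    R x = ‖x‖ • (EuclideanSpace.single (0 : Fin 3) (1:ℝ)) := by
  set e0 : E3 := EuclideanSpace.single (0 : Fin 3) (1:ℝ) with he0
  set e1 : E3 := EuclideanSpace.single (1 : Fin 3) (1:ℝ) with he1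
  have hn0 : ‖e0‖ = 1 := by simp [he0]
  have hn1 : ‖e1‖ = 1 := by simp [he1]
  have hdet : ∀ v : E3, v ≠ 0 → LinearMap.det ((ℝ ∙ v)ᗮ.reflection.toLinearEquiv : E3 →ₗ[ℝ] E3) = -1 := by
    intro v hv
    have := (ℝ ∙ v)ᗮ.det_reflection
    rw [Submodule.orthogonal_orthogonal, finrank_span_singleton hv, pow_one] at this
    exact this
  by_cases h : x = ‖x‖ • e0
  · refine ⟨LinearIsometryEquiv.refl ℝ E3, ?_, ?_⟩
    · exact LinearMap.det_id
    · simpa using h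
  · refine ⟨((ℝ ∙ (x - ‖x‖ • e0))ᗮ.reflection).trans ((ℝ ∙ e1)ᗮ.reflection), ?_, ?_⟩
    · have : ((((ℝ ∙ (x - ‖x‖ • e0))ᗮ.reflection).trans ((ℝ ∙ e1)ᗮ.reflection)).toLinearEquiv : E3 →ₗ[ℝ] E3)
        = ((ℝ ∙ e1)ᗮ.reflection.toLinearEquiv : E3 →ₗ[ℝ] E3) ∘ₗ
          ((ℝ ∙ (x - ‖x‖ • e0))ᗮ.reflection.toLinearEquiv : E3 →ₗ[ℝ] E3) := rfl
      rw [this, LinearMap.det_comp, hdet, hdet]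
      · norm_num
      · exact sub_ne_zero.2 h
      · intro h0; rw [h0] at hn1; simp at hn1
    · rw [LinearIsometryEquiv.trans_apply, Submodule.reflection_sub (by simp [norm_smul, hn0])]
      apply Submodule.reflection_mem_subspace_eq_self
      rw [Submodule.mem_orthogonal_singleton_iff_inner_right]
      rw [inner_smul_right]
      have : inner ℝ e1 e0 = 0 := by
        simp [he0, he1, EuclideanSpace.inner_single_left]
      rw [this, mul_zero]

theorem aux_rho_rad (f : Phase → ℝ) (hs : SphSym f) (x : E3) :
    rhoF f x = rhoF f (‖x‖ • (EuclideanSpace.single (0 : Fin 3) (1:ℝ))) := by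
  obtain ⟨R, hR, hx⟩ := aux_rot x
  rw [← hx]
  unfold rhoF
  rw [← (R.measurePreserving).integral_comp R.toMeasurableEquiv.measurableEmbedding (fun v => f (R x, v))]
  congr 1
  ext v
  exact (hs R hR (x, v)).symm

theorem aux_rho_meas (f : Phase → ℝ) (hm : Measurable f) : StronglyMeasurable (rhoF f) := by
  have := hm.stronglyMeasurable.integral_prod_right' (ν := (volume : Measure E3))
  exact this

theorem aux_rho_nonneg (f : Phase → ℝ) (hm : ∀ z, 0 ≤ f z) (x : E3) : 0 ≤ rhoF f x :=
  integral_nonneg fun _ => hm _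

theorem aux_phi (f : Phase → ℝ) (hf : memErad f) (r : ℝ) (hr : 0 ≤ r) :
    phiRad f r = - ∫ y : E3, rhoF f y / (4 * π) / max r ‖y‖ := by
  obtain ⟨⟨hm, hnn, -⟩, hs⟩ := hf
  have hρ := (aux_rho_meas f hm).measurable
  have hρ0 := aux_rho_nonneg f hnn
  unfold phiRad phiF
  congr 1
  rw [integral_eq_lintegral_of_nonneg_ae, integral_eq_lintegral_of_nonneg_ae]
  · congr 1
    have key := aux_shell (fun s => ENNReal.ofReal (rhoF f (s • (EuclideanSpace.single (0 : Fin 3) (1:ℝ))) / (4 * π)))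
      (by fun_prop) r hr
    simp_rw [← aux_rho_rad f hs] at key
    have hp : ∀ y, 0 ≤ rhoF f y / (4 * π) := fun y => div_nonneg (hρ0 y) (by positivity)
    simp_rw [← ENNReal.ofReal_mul (hp _)] at key
    convert key using 4
    · rw [mul_one_div, div_div]
    · rw [mul_one_div]
  · exact Eventually.of_forall fun y => div_nonneg (div_nonneg (hρ0 y) (by positivity)) (le_max_of_le_left hr)
  · exact (Measurable.div (by fun_prop) (by fun_prop)).aestronglyMeasurable
  · exact Eventually.of_forall fun y => div_nonneg (hρ0 y) (by positivity)
  · exact (Measurable.div (by fun_prop) (by fun_prop)).aestronglyMeasurable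

theorem aux_int (f : Phase → ℝ) (hf : memE f) : Integrable f := by
  obtain ⟨hm, hnn, h⟩ := hf
  have : eLpNorm f 1 volume < ⊤ := lt_of_le_of_lt (le_add_right (le_add_right le_rfl)) h
  exact memLp_one_iff_integrable.1 ⟨hm.aestronglyMeasurable, this⟩

theorem aux_intv (f : Phase → ℝ) (hf : memE f) : Integrable (fun z : Phase => ‖z.2‖ ^ 2 * f z) := by
  obtain ⟨hm, hnn, h⟩ := hf
  have : ∫⁻ z : Phase, (‖z.2‖₊ : ℝ≥0∞) ^ 2 * (‖f z‖₊ : ℝ≥0∞) < ⊤ := lt_of_le_of_lt (le_add_left le_rfl) h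
  refine ⟨(Measurable.mul (by fun_prop) hm).aestronglyMeasurable, ?_⟩
  rw [hasFiniteIntegral_iff_enorm]
  refine lt_of_eq_of_lt (lintegral_congr fun z => ?_) this
  rw [enorm_mul, enorm_pow, enorm_norm]
  rfl

theorem aux_ball : Integrable (fun z : Phase =>
    indicator {z : Phase | ‖z.1‖ < 1 ∧ ‖z.2‖ ^ 2 * ‖z.1‖ < 1} (fun z => 1 / ‖z.1‖) z) := by
  have hms : MeasurableSet {z : Phase | ‖z.1‖ < 1 ∧ ‖z.2‖ ^ 2 * ‖z.1‖ < 1} :=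
    by
    have h1 : MeasurableSet {z : Phase | ‖z.1‖ < 1} := measurableSet_lt (by fun_prop) (by fun_prop)
    have h2 : MeasurableSet {z : Phase | ‖z.2‖ ^ 2 * ‖z.1‖ < 1} :=
      measurableSet_lt (by fun_prop) (by fun_prop)
    exact h1.inter h2
  have hmeas : Measurable (fun z : Phase =>
    indicator {z : Phase | ‖z.1‖ < 1 ∧ ‖z.2‖ ^ 2 * ‖z.1‖ < 1} (fun z => 1 / ‖z.1‖) z) :=
    Measurable.indicator (by fun_prop) hms
  have hb : IntegrableOn (fun y : E3 => ‖y‖ ^ (-(5/2) : ℝ)) (Metric.ball 0 1) := by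
    refine integrableOn_ball_of_norm_le_rpow (C := 1) (α := 5/2) (by simp) (by simp; norm_num) ?_ ?_
    · refine Eventually.of_forall fun y => ?_
      rw [one_mul, Real.norm_of_nonneg (by positivity)]
    · have : Measurable (fun y : E3 => ‖y‖ ^ (-(5/2) : ℝ)) := Measurable.pow_const (by fun_prop) _
      exact this.aestronglyMeasurable
  refine ⟨hmeas.aestronglyMeasurable, ?_⟩
  rw [hasFiniteIntegral_iff_enorm, Measure.volume_eq_prod, lintegral_prod _ hmeas.enorm.aemeasurable]
  have hC : volume (Metric.ball (0:E3) 1) < ⊤ := measure_ball_lt_top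
  have hle : ∀ y : E3, y ≠ 0 → ∫⁻ v : E3, ‖indicator {z : Phase | ‖z.1‖ < 1 ∧ ‖z.2‖ ^ 2 * ‖z.1‖ < 1}
      (fun z => 1 / ‖z.1‖) (y, v)‖ₑ ≤
      (Metric.ball (0:E3) 1).indicator (fun y : E3 => ENNReal.ofReal (‖y‖ ^ (-(5/2) : ℝ))) y *
        volume (Metric.ball (0:E3) 1) := by
    intro y hy
    have hy0 : 0 < ‖y‖ := norm_pos_iff.2 hy
    by_cases hy1 : ‖y‖ < 1
    · rw [indicator_of_mem (by simpa using hy1)]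
      calc _ ≤ ∫⁻ v : E3, (Metric.ball (0:E3) (‖y‖ ^ (-(1/2) : ℝ))).indicator (fun _ => ENNReal.ofReal (1 / ‖y‖)) v := by
            apply lintegral_mono
            intro v
            by_cases hv : ‖v‖ ^ 2 * ‖y‖ < 1
            · simp only
              rw [indicator_of_mem (show (y, v) ∈ {z : Phase | ‖z.1‖ < 1 ∧ ‖z.2‖ ^ 2 * ‖z.1‖ < 1} from ⟨hy1, hv⟩),
                indicator_of_mem, Real.enorm_of_nonneg (by positivity)]
              rw [mem_ball_zero_iff]
              refine lt_of_pow_lt_pow_left₀ 2 (by positivity) ?_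
              rw [← Real.rpow_natCast (‖y‖ ^ (-(1/2) : ℝ)), ← Real.rpow_mul hy0.le]
              norm_num
              rw [Real.rpow_neg_one]
              rw [← one_div, lt_div_iff₀ hy0]
              exact hv
            · simp only
              rw [indicator_of_notMem (fun h : (y, v) ∈ {z : Phase | ‖z.1‖ < 1 ∧ ‖z.2‖ ^ 2 * ‖z.1‖ < 1} => hv h.2)]
              simp
        _ = _ := by
            rw [lintegral_indicator_const measurableSet_ball, Measure.addHaar_ball _ _ (by positivity), ← mul_assoc,
              ← ENNReal.ofReal_mul (by positivity)]
            congr 2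
            rw [finrank_euclideanSpace, Fintype.card_fin, ← Real.rpow_natCast (‖y‖ ^ (-(1/2) : ℝ)),
              ← Real.rpow_mul hy0.le, one_div, ← Real.rpow_neg_one, ← Real.rpow_add hy0]
            norm_num
    · refine le_trans (le_of_eq ?_) zero_le
      rw [lintegral_eq_zero_iff']
      · refine Eventually.of_forall fun v => ?_
        simp only
        rw [indicator_of_notMem (fun h : (y, v) ∈ {z : Phase | ‖z.1‖ < 1 ∧ ‖z.2‖ ^ 2 * ‖z.1‖ < 1} => hy1 h.1)]
        simp
      · exact (hmeas.comp (measurable_const.prodMk measurable_id)).enorm.aemeasurable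
  have hae : ∀ᵐ y : E3, y ≠ 0 := by
    rw [ae_iff]; simp
  refine lt_of_le_of_lt (lintegral_mono_ae (hae.mono hle)) ?_
  rw [lintegral_mul_const' _ _ hC.ne, lintegral_indicator measurableSet_ball]
  refine ENNReal.mul_lt_top ?_ hC
  exact hb.lintegral_lt_top

theorem aux_int_div (f : Phase → ℝ) (hf : memE f) : Integrable (fun z : Phase => f z / ‖z.1‖) := by
  obtain ⟨hm, hnn, h⟩ := id hf
  have htop : eLpNorm f ⊤ volume < ⊤ :=
    lt_of_le_of_lt (le_add_right (le_add_left le_rfl)) h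
  have hbd := ae_le_eLpNormEssSup (f := f) (μ := volume)
  rw [← eLpNorm_exponent_top] at hbd
  set M := (eLpNorm f ⊤ volume).toReal with hM
  have hfM : ∀ᵐ z, f z ≤ M := by
    filter_upwards [hbd] with z hz
    rw [Real.enorm_of_nonneg (hnn z)] at hz
    exact (ENNReal.ofReal_le_iff_le_toReal htop.ne).1 hz
  refine Integrable.mono' (((aux_int f hf).add (aux_intv f hf)).add (aux_ball.const_mul M))
    (Measurable.div hm (by fun_prop)).aestronglyMeasurable ?_
  filter_upwards [hfM] with z hz
  rw [Real.norm_of_nonneg (div_nonneg (hnn z) (norm_nonneg _))]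
  simp only [Pi.add_apply]
  have hfz := hnn z
  have hM0 : 0 ≤ M := hfz.trans hz
  have hi : 0 ≤ indicator {z : Phase | ‖z.1‖ < 1 ∧ ‖z.2‖ ^ 2 * ‖z.1‖ < 1} (fun z => 1 / ‖z.1‖) z :=
    indicator_nonneg (fun z _ => by positivity) z
  rcases (norm_nonneg z.1).eq_or_lt with h0 | h0
  · rw [← h0]; simp only [div_zero]; positivity
  by_cases h1 : ‖z.1‖ < 1
  · by_cases h2 : ‖z.2‖ ^ 2 * ‖z.1‖ < 1
    · rw [indicator_of_mem (show z ∈ {z : Phase | ‖z.1‖ < 1 ∧ ‖z.2‖ ^ 2 * ‖z.1‖ < 1} from ⟨h1, h2⟩)]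
      have : f z / ‖z.1‖ ≤ M * (1 / ‖z.1‖) := by rw [mul_one_div]; gcongr
      have : 0 ≤ ‖z.2‖ ^ 2 * f z := by positivity
      linarith
    · have : f z / ‖z.1‖ ≤ ‖z.2‖ ^ 2 * f z := by
        rw [div_le_iff₀ h0]
        nlinarith
      have := mul_nonneg hM0 hi
      linarith
  · have : f z / ‖z.1‖ ≤ f z := div_le_self hfz (not_lt.1 h1)
    have := mul_nonneg hM0 hi
    have : 0 ≤ ‖z.2‖ ^ 2 * f z := by positivity
    linarith

theorem aux_rho_int (f : Phase → ℝ) (hf : memE f) : Integrable (rhoF f) :=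
  (aux_int f hf).integral_prod_left

theorem aux_rho_int_div (f : Phase → ℝ) (hf : memE f) : Integrable (fun y => rhoF f y / ‖y‖) := by
  have := (aux_int_div f hf).integral_prod_left
  simp only [integral_div] at this
  exact this

theorem aux_mass (f : Phase → ℝ) (hf : memE f) : ∫ y, rhoF f y = mass f :=
  (integral_prod f (aux_int f hf)).symm

theorem aux_mass_pos (f : Phase → ℝ) (hf : memE f) (hf0 : ¬ f =ᵐ[volume] (0 : Phase → ℝ)) : 0 < mass f := by
  have h0 : 0 ≤ mass f := integral_nonneg hf.2.1
  refine h0.lt_of_ne fun h => hf0 ?_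
  exact (integral_eq_zero_iff_of_nonneg hf.2.1 (aux_int f hf)).1 h.symm

theorem aux_max_int (σ : E3 → ℝ) (hσ : Integrable σ) (r : ℝ) (hr : 0 < r) :
    Integrable (fun y => σ y / max r ‖y‖) := by
  refine Integrable.mono' (hσ.norm.div_const r)
    (hσ.aestronglyMeasurable.aemeasurable.div (by fun_prop)).aestronglyMeasurable ?_
  refine Eventually.of_forall fun y => ?_
  have : r ≤ max r ‖y‖ := le_max_left _ _
  rw [norm_div, Real.norm_of_nonneg (hr.le.trans this)]
  gcongr

theorem aux_sphere (r : ℝ) : ∀ᵐ y : E3, ‖y‖ ≠ r := by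
  rw [ae_iff]
  have := Measure.addHaar_sphere (volume : Measure E3) 0 r
  convert this using 2
  ext y
  simp

theorem aux_deriv (σ : E3 → ℝ) (hσ : Integrable σ) (hσ0 : ∀ y, 0 ≤ σ y) (r : ℝ) (hr : 0 < r) :
    HasDerivAt (fun r => - ∫ y, σ y / max r ‖y‖)
      ((∫ y, (Metric.ball (0:E3) r).indicator σ y) / r ^ 2) r := by
  have key := hasDerivAt_integral_of_dominated_loc_of_lip (μ := (volume : Measure E3)) (x₀ := r) (s := Ioi (r / 2))
    (F := fun x y => σ y / max x ‖y‖) (F' := fun y => -((Metric.ball (0:E3) r).indicator σ y / r ^ 2))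
    (bound := fun y => σ y / (r / 2) ^ 2) (Ioi_mem_nhds (by linarith))
    (Eventually.of_forall fun x =>
      (hσ.aestronglyMeasurable.aemeasurable.div (by fun_prop)).aestronglyMeasurable)
    (aux_max_int σ hσ r hr)
    ((hσ.indicator Metric.isOpen_ball.measurableSet).div_const _).neg.aestronglyMeasurable
    ?_ (hσ.div_const _) ?_
  · have h2 := key.2.neg
    refine h2.congr_deriv ?_
    rw [integral_neg, integral_div, neg_neg]
  · refine Eventually.of_forall fun y => LipschitzOnWith.of_dist_le_mul ?_
    intro a ha b hb
    have ha : r / 2 < a := ha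
    have hb : r / 2 < b := hb
    have hA : r / 2 ≤ max a ‖y‖ := ha.le.trans (le_max_left _ _)
    have hB : r / 2 ≤ max b ‖y‖ := hb.le.trans (le_max_left _ _)
    have hr2 : 0 < r / 2 := by linarith
    have hAB := abs_max_sub_max_le_abs a b ‖y‖
    set A := max a ‖y‖
    set B := max b ‖y‖
    have hA0 : 0 < A := hr2.trans_le hA
    have hB0 : 0 < B := hr2.trans_le hB
    have hc : ((Real.nnabs (σ y / (r / 2) ^ 2) : ℝ≥0) : ℝ) = σ y / (r / 2) ^ 2 := by
      rw [Real.coe_nnabs, abs_of_nonneg (div_nonneg (hσ0 y) (by positivity))]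
    rw [hc, Real.dist_eq, Real.dist_eq]
    have e : σ y / A - σ y / B = σ y * (B - A) / (A * B) := by field_simp
    rw [e, abs_div, abs_mul, abs_of_nonneg (hσ0 y), abs_of_pos (mul_pos hA0 hB0), abs_sub_comm B A]
    rw [div_mul_eq_mul_div]
    have := hσ0 y
    rw [pow_two]
    gcongr
  · filter_upwards [aux_sphere r] with y hy
    rcases lt_or_gt_of_ne hy with h | h
    · rw [indicator_of_mem (by simpa using h)]
      have h1 : HasDerivAt (fun x => σ y / x) (-(σ y / r ^ 2)) r := by
        have := (hasDerivAt_inv hr.ne').const_mul (σ y)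
        simp only [div_eq_mul_inv]
        refine this.congr_deriv ?_
        ring
      refine h1.congr_of_eventuallyEq ?_
      filter_upwards [Ioi_mem_nhds h] with x hx
      rw [max_eq_left (le_of_lt hx)]
    · rw [indicator_of_notMem (by simpa using h.le)]
      simp only [zero_div, neg_zero]
      refine (hasDerivAt_const r (σ y / ‖y‖)).congr_of_eventuallyEq ?_
      filter_upwards [Iio_mem_nhds h] with x hx
      rw [max_eq_right (le_of_lt hx)]

theorem aux_mcont (σ : E3 → ℝ) (hσ : Integrable σ) :
    Continuous (fun r => ∫ y, (Metric.ball (0:E3) r).indicator σ y) := by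
  rw [continuous_iff_continuousAt]
  intro r
  refine continuousAt_of_dominated (bound := fun y => ‖σ y‖) ?_ ?_ hσ.norm ?_
  · exact Eventually.of_forall fun x => (hσ.indicator Metric.isOpen_ball.measurableSet).aestronglyMeasurable
  · exact Eventually.of_forall fun x => Eventually.of_forall fun y => norm_indicator_le_norm_self _ _
  · filter_upwards [aux_sphere r] with y hy
    rcases lt_or_gt_of_ne hy with h | h
    · refine (continuousAt_const (y := σ y)).congr ?_
      filter_upwards [Ioi_mem_nhds h] with x hx
      rw [indicator_of_mem (by simpa using hx)]
    · refine (continuousAt_const (y := (0:ℝ))).congr ?_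
      filter_upwards [Iio_mem_nhds h] with x hx
      rw [indicator_of_notMem (by simpa using (le_of_lt hx))]

theorem aux_mmono (σ : E3 → ℝ) (hσ : Integrable σ) (hσ0 : ∀ y, 0 ≤ σ y) :
    Monotone (fun r => ∫ y, (Metric.ball (0:E3) r).indicator σ y) := by
  intro a b hab
  refine integral_mono (hσ.indicator Metric.isOpen_ball.measurableSet)
    (hσ.indicator Metric.isOpen_ball.measurableSet) ?_
  exact indicator_le_indicator_of_subset (Metric.ball_subset_ball hab) hσ0

theorem aux_mtop (σ : E3 → ℝ) (hσ : Integrable σ) :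
    Tendsto (fun r => ∫ y, (Metric.ball (0:E3) r).indicator σ y) atTop (𝓝 (∫ y, σ y)) := by
  refine tendsto_integral_filter_of_dominated_convergence (fun y => ‖σ y‖) ?_ ?_ hσ.norm ?_
  · exact Eventually.of_forall fun x => (hσ.indicator Metric.isOpen_ball.measurableSet).aestronglyMeasurable
  · exact Eventually.of_forall fun x => Eventually.of_forall fun y => norm_indicator_le_norm_self _ _
  · refine Eventually.of_forall fun y => ?_
    refine tendsto_const_nhds.congr' ?_
    filter_upwards [Ioi_mem_atTop ‖y‖] with x hx
    rw [indicator_of_mem (by simpa using hx)]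

/-- One-dimensional analysis. -/
theorem aux_1d (φ m : ℝ → ℝ) (M : ℝ) (hM : 0 < M) (hd : ∀ r, 0 < r → HasDerivAt φ (m r / r ^ 2) r)
    (hmc : Continuous m) (hmm : Monotone m) (hmt : Tendsto m atTop (𝓝 M))
    (h0 : ∀ r, 0 < r → φ 0 ≤ φ r) (hlo : ∀ r, 0 < r → - (M / r) ≤ φ r) (hhi : ∀ r, 0 < r → φ r ≤ 0) :
    (∀ ℓ : ℝ, 0 < ℓ →
      ContDiffOn ℝ 1 (psiPot φ ℓ) (Ioi 0) ∧
      (∃ r₀ : ℝ, 0 < r₀ ∧ psiPot φ ℓ r₀ = eMinPot φ ℓ ∧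
        (∀ r : ℝ, 0 < r → psiPot φ ℓ r = eMinPot φ ℓ → r = r₀) ∧
        StrictAntiOn (psiPot φ ℓ) (Ioo 0 r₀) ∧
        StrictMonoOn (psiPot φ ℓ) (Ioi r₀)) ∧
      Tendsto (psiPot φ ℓ) (nhdsWithin 0 (Ioi 0)) atTop ∧
      Tendsto (psiPot φ ℓ) atTop (nhds 0)) ∧
    ContinuousOn (fun ℓ : ℝ => eMinPot φ ℓ) (Ioi 0) ∧
    (∀ ℓ : ℝ, 0 < ℓ →
      max (φ 0) (-M ^ 2 / (2 * ℓ)) ≤ eMinPot φ ℓ ∧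
      eMinPot φ ℓ < 0) := by
  have hψd : ∀ ℓ r, 0 < r → HasDerivAt (psiPot φ ℓ) ((r * m r - ℓ) / r ^ 3) r := by
    intro ℓ r hr
    have h1 : HasDerivAt (fun r : ℝ => ℓ / (2 * r ^ 2)) (-(ℓ / r ^ 3)) r := by
      have a := ((hasDerivAt_pow 2 r).const_mul 2).inv (by positivity) |>.const_mul ℓ
      simp only [div_eq_mul_inv ℓ]
      refine a.congr_deriv ?_
      field_simp
      simp
    refine ((hd r hr).add h1).congr_deriv ?_
    field_simp
    ring
  have hψlo : ∀ ℓ, 0 < ℓ → ∀ r, 0 < r → φ 0 ≤ psiPot φ ℓ r := by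
    intro ℓ hℓ r hr
    have : 0 ≤ ℓ / (2 * r ^ 2) := by positivity
    have := h0 r hr
    unfold psiPot
    linarith
  have hψlo2 : ∀ ℓ, 0 < ℓ → ∀ r, 0 < r → -M ^ 2 / (2 * ℓ) ≤ psiPot φ ℓ r := by
    intro ℓ hℓ r hr
    have := hlo r hr
    unfold psiPot
    have : -M ^ 2 / (2 * ℓ) ≤ - (M / r) + ℓ / (2 * r ^ 2) := by
      have e : - (M / r) + ℓ / (2 * r ^ 2) - -M ^ 2 / (2 * ℓ) = (M * r - ℓ) ^ 2 / (2 * ℓ * r ^ 2) := by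
        field_simp
        ring
      have : 0 ≤ (M * r - ℓ) ^ 2 / (2 * ℓ * r ^ 2) := by positivity
      linarith
    linarith
  have hne : ∀ ℓ, (psiPot φ ℓ '' Ioi 0).Nonempty := fun ℓ => ⟨_, 1, by simp, rfl⟩
  have hbdd : ∀ ℓ, 0 < ℓ → BddBelow (psiPot φ ℓ '' Ioi 0) := by
    intro ℓ hℓ
    refine ⟨φ 0, ?_⟩
    rintro _ ⟨r, hr, rfl⟩
    exact hψlo ℓ hℓ r hr
  have hmle : ∀ r, m r ≤ M := fun r => hmm.ge_of_tendsto hmt r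
  have hatTop : ∀ ℓ, Tendsto (psiPot φ ℓ) atTop (nhds 0) := by
    intro ℓ
    have a : Tendsto (fun r : ℝ => ℓ / (2 * r ^ 2)) atTop (𝓝 0) := by
      refine Tendsto.const_div_atTop ?_ ℓ
      exact (tendsto_pow_atTop (by norm_num)).const_mul_atTop (by norm_num)
    have b : Tendsto φ atTop (𝓝 0) := by
      have c : Tendsto (fun r : ℝ => -(M / r)) atTop (𝓝 0) := by
        have := (Tendsto.const_div_atTop tendsto_id M).neg
        simpa using this
      refine tendsto_of_tendsto_of_tendsto_of_le_of_le' c tendsto_const_nhds ?_ ?_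
      · filter_upwards [Ioi_mem_atTop 0] with r hr using hlo r hr
      · filter_upwards [Ioi_mem_atTop 0] with r hr using hhi r hr
    have := b.add a
    rw [add_zero] at this
    exact this
  have hmain : ∀ ℓ, 0 < ℓ → ∃ r₀ : ℝ, 0 < r₀ ∧ StrictAntiOn (psiPot φ ℓ) (Ioc 0 r₀) ∧
      StrictMonoOn (psiPot φ ℓ) (Ici r₀) := by
    intro ℓ hℓ
    obtain ⟨r1, hr1⟩ := (hmt.eventually (lt_mem_nhds (half_lt_self hM))).exists
    have hex : ∃ r₀, 0 < r₀ ∧ r₀ * m r₀ = ℓ := by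
      set a := ℓ / (2 * M) with ha
      set b := max r1 (max a (2 * ℓ / M)) with hb
      have ha0 : 0 < a := by positivity
      have hab : a ≤ b := (le_max_left _ _).trans (le_max_right _ _)
      have h1 : a * m a ≤ ℓ := by
        have : a * M = ℓ / 2 := by rw [ha]; field_simp
        nlinarith [hmle a]
      have h2 : ℓ ≤ b * m b := by
        have h3 : M / 2 < m b := hr1.trans_le (hmm (le_max_left _ _))
        have h4 : 2 * ℓ / M ≤ b := (le_max_right _ _).trans (le_max_right _ _)
        rw [div_le_iff₀ hM] at h4
        nlinarith [ha0.trans_le hab]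
      have := intermediate_value_Icc hab (f := fun r => r * m r) (by fun_prop) ⟨h1, h2⟩
      obtain ⟨r₀, hr₀, he⟩ := this
      exact ⟨r₀, ha0.trans_le hr₀.1, he⟩
    obtain ⟨r₀, hr₀, he⟩ := hex
    have hm0 : 0 < m r₀ := by
      by_contra hc
      nlinarith [not_lt.1 hc]
    refine ⟨r₀, hr₀, ?_, ?_⟩
    · refine strictAntiOn_of_deriv_neg (convex_Ioc 0 r₀) ?_ ?_
      · intro r hr
        exact (hψd ℓ r hr.1).continuousAt.continuousWithinAt
      · intro r hr
        rw [interior_Ioc] at hr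
        have h0r := hr.1
        rw [(hψd ℓ r hr.1).deriv]
        refine div_neg_of_neg_of_pos ?_ (by positivity)
        have := hmm hr.2.le
        nlinarith [hr.2]
    · refine strictMonoOn_of_deriv_pos (convex_Ici r₀) ?_ ?_
      · intro r hr
        exact (hψd ℓ r (hr₀.trans_le hr)).continuousAt.continuousWithinAt
      · intro r hr
        rw [interior_Ici] at hr
        have hr' : r₀ < r := hr
        have h0r := hr₀.trans hr'
        rw [(hψd ℓ r h0r).deriv]
        refine div_pos ?_ (by positivity)
        have := hmm hr'.le
        nlinarith
  have hmin : ∀ ℓ, 0 < ℓ → ∀ r₀, 0 < r₀ → StrictAntiOn (psiPot φ ℓ) (Ioc 0 r₀) →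
      StrictMonoOn (psiPot φ ℓ) (Ici r₀) →
      (∀ r, 0 < r → r ≠ r₀ → psiPot φ ℓ r₀ < psiPot φ ℓ r) ∧ psiPot φ ℓ r₀ = eMinPot φ ℓ := by
    intro ℓ hℓ r₀ hr₀ h1 h2
    have h3 : ∀ r, 0 < r → r ≠ r₀ → psiPot φ ℓ r₀ < psiPot φ ℓ r := by
      intro r hr hne
      rcases lt_or_gt_of_ne hne with h | h
      · exact h1 ⟨hr, h.le⟩ ⟨hr₀, le_rfl⟩ h
      · exact h2 self_mem_Ici h.le h
    refine ⟨h3, ?_⟩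
    have : IsLeast (psiPot φ ℓ '' Ioi 0) (psiPot φ ℓ r₀) := by
      refine ⟨⟨r₀, hr₀, rfl⟩, ?_⟩
      rintro _ ⟨r, hr, rfl⟩
      by_cases h : r = r₀
      · rw [h]
      · exact (h3 r hr h).le
    exact this.csInf_eq.symm
  refine ⟨fun ℓ hℓ => ⟨?_, ?_, ?_, hatTop ℓ⟩, ?_, fun ℓ hℓ => ⟨?_, ?_⟩⟩
  · rw [contDiffOn_one_iff_derivWithin (uniqueDiffOn_Ioi 0)]
    constructor
    · intro r hr
      exact (hψd ℓ r hr).differentiableAt.differentiableWithinAt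
    · have : ContinuousOn (fun r => (r * m r - ℓ) / r ^ 3) (Ioi 0) := by
        refine ContinuousOn.div (by fun_prop) (by fun_prop) ?_
        intro r hr
        have hr : 0 < r := hr
        positivity
      refine this.congr ?_
      intro r hr
      exact (hψd ℓ r hr).hasDerivWithinAt.derivWithin (uniqueDiffOn_Ioi 0 r hr)
  · obtain ⟨r₀, hr₀, h1, h2⟩ := hmain ℓ hℓ
    obtain ⟨h3, h4⟩ := hmin ℓ hℓ r₀ hr₀ h1 h2
    refine ⟨r₀, hr₀, h4, ?_, h1.mono Ioo_subset_Ioc_self, h2.mono Ioi_subset_Ici_self⟩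
    intro r hr he
    by_contra hne
    have := h3 r hr hne
    linarith
  · have a : Tendsto (fun r : ℝ => φ 0 + ℓ / (2 * r ^ 2)) (𝓝[>] 0) atTop := by
      refine tendsto_atTop_add_const_left _ _ ?_
      have b : Tendsto (fun r : ℝ => (2 * r ^ 2)) (𝓝[>] 0) (𝓝[>] 0) := by
        refine tendsto_nhdsWithin_iff.2 ⟨?_, ?_⟩
        · have : Continuous (fun r : ℝ => 2 * r ^ 2) := by fun_prop
          have := this.tendsto 0
          simp only [ne_eq, OfNat.ofNat_ne_zero, not_false_eq_true, zero_pow, mul_zero] at this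
          exact this.mono_left nhdsWithin_le_nhds
        · filter_upwards [self_mem_nhdsWithin] with r hr
          have hr : 0 < r := hr
          exact mem_Ioi.2 (by positivity)
      simp only [div_eq_mul_inv]
      exact (tendsto_inv_nhdsGT_zero.comp b).const_mul_atTop hℓ
    refine tendsto_atTop_mono' _ ?_ a
    filter_upwards [self_mem_nhdsWithin] with r hr
    have := h0 r hr
    unfold psiPot
    linarith
  · refine ConcaveOn.continuousOn isOpen_Ioi ⟨convex_Ioi 0, ?_⟩
    intro x hx y hy a b ha hb hab
    have hx : 0 < x := hx
    have hy : 0 < y := hy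
    refine le_csInf (hne _) ?_
    rintro _ ⟨r, hr, rfl⟩
    have h1 : eMinPot φ x ≤ psiPot φ x r := csInf_le (hbdd x hx) ⟨r, hr, rfl⟩
    have h2 : eMinPot φ y ≤ psiPot φ y r := csInf_le (hbdd y hy) ⟨r, hr, rfl⟩
    have e : psiPot φ (a • x + b • y) r = a * psiPot φ x r + b * psiPot φ y r := by
      unfold psiPot
      simp only [smul_eq_mul]
      have hb' : b = 1 - a := by linarith
      rw [hb']
      ring
    rw [e]
    simp only [smul_eq_mul]
    gcongr
  · refine le_csInf (hne _) ?_
    rintro _ ⟨r, hr, rfl⟩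
    exact max_le (hψlo ℓ hℓ r hr) (hψlo2 ℓ hℓ r hr)
  · obtain ⟨r₀, hr₀, h1, h2⟩ := hmain ℓ hℓ
    obtain ⟨h3, h4⟩ := hmin ℓ hℓ r₀ hr₀ h1 h2
    rw [← h4]
    have h5 := h2 self_mem_Ici (show r₀ + 1 ∈ Ici r₀ by simp) (by linarith)
    refine h5.trans_le (ge_of_tendsto (hatTop ℓ) ?_)
    filter_upwards [Ici_mem_atTop (r₀ + 1)] with r hr
    have hr : r₀ + 1 ≤ r := hr
    exact h2.monotoneOn (show r₀ + 1 ∈ Ici r₀ by simp) (show r₀ ≤ r by linarith) hr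

/-- Structure of the effective potential `ψ_{φ,ℓ}` for `φ = φ_f`, `f ∈ E_rad` nonzero. -/
theorem stmt4 (f : Phase → ℝ) (hf : memErad f)
    (hf0 : ¬ f =ᵐ[volume] (0 : Phase → ℝ)) :
    (∀ ℓ : ℝ, 0 < ℓ →
      ContDiffOn ℝ 1 (psiPot (phiRad f) ℓ) (Ioi 0) ∧
      (∃ r₀ : ℝ, 0 < r₀ ∧ psiPot (phiRad f) ℓ r₀ = eMinPot (phiRad f) ℓ ∧
        (∀ r : ℝ, 0 < r → psiPot (phiRad f) ℓ r = eMinPot (phiRad f) ℓ → r = r₀) ∧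
        StrictAntiOn (psiPot (phiRad f) ℓ) (Ioo 0 r₀) ∧
        StrictMonoOn (psiPot (phiRad f) ℓ) (Ioi r₀)) ∧
      Tendsto (psiPot (phiRad f) ℓ) (nhdsWithin 0 (Ioi 0)) atTop ∧
      Tendsto (psiPot (phiRad f) ℓ) atTop (nhds 0)) ∧
    ContinuousOn (fun ℓ : ℝ => eMinPot (phiRad f) ℓ) (Ioi 0) ∧
    (∀ ℓ : ℝ, 0 < ℓ →
      max (phiRad f 0) (-(mass f) ^ 2 / (2 * ℓ)) ≤ eMinPot (phiRad f) ℓ ∧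
      eMinPot (phiRad f) ℓ < 0) := by
  have hE := hf.1
  have hM := aux_mass_pos f hE hf0
  set σ : E3 → ℝ := fun y => rhoF f y / (4 * π) with hσd
  have hσ : Integrable σ := (aux_rho_int f hE).div_const _
  have hσ0 : ∀ y, 0 ≤ σ y := fun y => div_nonneg (aux_rho_nonneg f hE.2.1 y) (by positivity)
  have hσn : Integrable (fun y => σ y / max 0 ‖y‖) := by
    refine ((aux_rho_int_div f hE).div_const (4 * π)).congr (Eventually.of_forall fun y => ?_)
    simp only [hσd, max_eq_right (norm_nonneg y)]
    ring
  have hI : ∫ y, σ y = mass f / (4 * π) := by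
    rw [← aux_mass f hE, ← integral_div]
  have hφ : ∀ r, 0 ≤ r → phiRad f r = - ∫ y, σ y / max r ‖y‖ := fun r hr => aux_phi f hf r hr
  have h4 : 1 ≤ 4 * π := by linarith [pi_gt_three]
  have hIle : ∫ y, σ y ≤ mass f := by rw [hI]; exact div_le_self hM.le h4
  have hI0 : 0 < ∫ y, σ y := by rw [hI]; positivity
  have key := aux_1d (phiRad f) (fun r => ∫ y, (Metric.ball (0:E3) r).indicator σ y) (∫ y, σ y) hI0
    (fun r hr => (aux_deriv σ hσ hσ0 r hr).congr_of_eventuallyEq (by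
      filter_upwards [Ioi_mem_nhds hr] with x hx using hφ x (le_of_lt hx)))
    (aux_mcont σ hσ) (aux_mmono σ hσ hσ0) (aux_mtop σ hσ) ?_ ?_ ?_
  · refine ⟨key.1, key.2.1, fun ℓ hℓ => ⟨le_trans (max_le_max le_rfl ?_) (key.2.2 ℓ hℓ).1, (key.2.2 ℓ hℓ).2⟩⟩
    gcongr
  · intro r hr
    rw [hφ 0 le_rfl, hφ r hr.le]
    refine neg_le_neg (integral_mono_ae (aux_max_int σ hσ r hr) hσn ?_)
    filter_upwards [aux_sphere 0] with y hy
    have : 0 < ‖y‖ := (norm_nonneg y).lt_of_ne hy.symm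
    have := hσ0 y
    rw [max_eq_right (norm_nonneg y)]
    gcongr
    exact le_max_right _ _
  · intro r hr
    rw [hφ r hr.le, ← integral_div]
    refine neg_le_neg (integral_mono (aux_max_int σ hσ r hr) (hσ.div_const r) ?_)
    intro y
    have := hσ0 y
    simp only
    gcongr
    exact le_max_left _ _
  · intro r hr
    rw [hφ r hr.le]
    refine neg_nonpos.2 (integral_nonneg fun y => div_nonneg (hσ0 y) (le_max_of_le_left hr.le))
end
end
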